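/- Let K be a field of characteristic 0, let L ∈ K^{(d+1)×(n+1)} have rank d+1, let 𝕃 ⊂ ℙ^n(K̄) be a linear subspace of dimension n−d defined over K such that K̄[ℛ_L]/I(𝕃) has Krull dimension 1, and let h ∈ K[ℛ_L] be a homogeneous element of degree k such that K̄[ℛ_L]/(I(𝕃) + ⟨h⟩) has Krull dimension 0 (geometrically: 𝕃 ∩ ℛ_L is finite and h vanishes at none of its points). Then HReg(K[ℛ_L]/(I(𝕃) + ⟨h⟩)) ≤ d + k, and the Hilbert function HF_{K[ℛ_L]/(I(𝕃)+⟨h⟩)}(q) = 0 for all q ≥ d + k. -/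

import Mathlib

open scoped BigOperators
noncomputable section

namespace ScatteringPaper

open CategoryTheory AlgebraicTopology

/- ## Topological Euler characteristic via rational singular homology -/

/-- The singular chain complex of a topological space, with rational coefficients. -/
def singularChainComplex (X : Type) [TopologicalSpace X] : ChainComplex (ModuleCat ℚ) ℕ :=
  (alternatingFaceMapComplex (ModuleCat ℚ)).obj
    (((SimplicialObject.whiskering _ _).obj (ModuleCat.free ℚ)).obj (TopCat.toSSet.obj (TopCat.of X)))

/-- The `q`-th (rational) Betti number of a topological space. -/
def betti (X : Type) [TopologicalSpace X] (q : ℕ) : ℕ :=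
  Module.finrank ℚ ((singularChainComplex X).homology q)

/-- The topological Euler characteristic, as the alternating sum of Betti numbers. -/
def eulerChar (X : Type) [TopologicalSpace X] : ℤ :=
  ∑ᶠ q : ℕ, (-1 : ℤ) ^ q * (betti X q : ℤ)

variable {d : ℕ} {ι : Type} [Fintype ι] [DecidableEq ι]

/- ## Hyperplane arrangements: `(ℓ_i(x))_i = (1, x_1, …, x_d) · L` -/

/-- Value of the affine-linear form encoded by column `i` of `L`. -/
def ell (K : Type) [Field K] (L : Matrix (Fin (d+1)) ι K) (x : Fin d → K) (i : ι) : K :=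
  L 0 i + ∑ j : Fin d, x j * L j.succ i

/-- The complement `X = ℂ^d ∖ 𝒜` of the arrangement `𝒜 = V(∏ ℓ_i)`. -/
def complementX (L : Matrix (Fin (d+1)) ι ℂ) : Set (Fin d → ℂ) := {x | ∀ i, ell ℂ L x i ≠ 0}

/-- `x ∈ X` is a solution of the scattering equations
`∂ℒ_u/∂x_k = ∑_i u_i a_{ki}/ℓ_i(x) = 0`, `k = 1, …, d`. -/
def IsSol (L : Matrix (Fin (d+1)) ι ℂ) (u : ι → ℂ) (x : Fin d → ℂ) : Prop :=
  x ∈ complementX L ∧ ∀ k : Fin d, ∑ i : ι, u i * L k.succ i / ell ℂ L x i = 0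

/-- An arrangement is essential if some subset of its hyperplanes meets in a single point. -/
def IsEssential (L : Matrix (Fin (d+1)) ι ℂ) : Prop :=
  ∃ (S : Set ι) (x₀ : Fin d → ℂ), {x : Fin d → ℂ | ∀ i ∈ S, ell ℂ L x i = 0} = {x₀}

/-- `P u` holds for all `u` outside a proper algebraic subset (i.e. for generic `u`). -/
def Generically {σ : Type} [Fintype σ] [DecidableEq σ] (P : (σ → ℂ) → Prop) : Prop :=
  ∃ g : MvPolynomial σ ℂ, g ≠ 0 ∧ ∀ u : σ → ℂ, MvPolynomial.eval u g ≠ 0 → P u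

/- ## Matroid data of the columns of `L` -/

/-- Rank of the set `I` of columns of `L` (the matroid rank in `M(L)`). -/
def rkL (K : Type) [Field K] (L : Matrix (Fin (d+1)) ι K) (I : Set ι) : ℕ :=
  Module.finrank K (Submodule.span K ((fun i => fun r => L r i) '' I))

/-- Rank of the set `I` of columns of `A^⊤` (`L` with its first row deleted). -/
def rkA (K : Type) [Field K] (L : Matrix (Fin (d+1)) ι K) (I : Set ι) : ℕ :=
  Module.finrank K (Submodule.span K ((fun i => fun k : Fin d => L k.succ i) '' I))

/-- `I` is a flat of the matroid `M(L)`. -/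
def IsFlat (K : Type) [Field K] (L : Matrix (Fin (d+1)) ι K) (I : Set ι) : Prop :=
  ∀ i ∉ I, rkL K L I < rkL K L (insert i I)

/-- `C` is a circuit of `M(L)`: a minimal linearly dependent set of columns. -/
def IsCircuit (K : Type) [Field K] (L : Matrix (Fin (d+1)) ι K) (C : Finset ι) : Prop :=
  (¬ LinearIndependent K (fun i : {a // a ∈ C} => fun r => L r i.1)) ∧
  ∀ D : Finset ι, D ⊂ C → LinearIndependent K (fun i : {a // a ∈ D} => fun r => L r i.1)

/-- `M(L)` is connected: there is no separation into two nonempty parts with additive rank. -/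
def MatroidConnected (K : Type) [Field K] (L : Matrix (Fin (d+1)) ι K) : Prop :=
  ∀ S : Set ι, S.Nonempty → Sᶜ.Nonempty → rkL K L S + rkL K L Sᶜ ≠ rkL K L Set.univ

/- ## The reciprocal linear space -/

/-- Zariski closure of a subset of affine space `K^ι`. -/
def zarClosure (K : Type) [Field K] (S : Set (ι → K)) : Set (ι → K) :=
  {v | ∀ f : MvPolynomial ι K, (∀ w ∈ S, MvPolynomial.eval w f = 0) → MvPolynomial.eval v f = 0}

/-- The affine cone over the image of `φ : x ↦ (ℓ_0(x)⁻¹ : ⋯ : ℓ_n(x)⁻¹)`. -/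
def coneImage (L : Matrix (Fin (d+1)) ι ℂ) : Set (ι → ℂ) :=
  {v | ∃ (c : ℂ) (x : Fin d → ℂ), x ∈ complementX L ∧ v = fun i => c / ell ℂ L x i}

/-- The vanishing ideal of a subset of affine space. -/
def vanishingIdeal (K : Type) [Field K] (S : Set (ι → K)) : Ideal (MvPolynomial ι K) where
  carrier := {f | ∀ v ∈ S, MvPolynomial.eval v f = 0}
  add_mem' := by
    intro a b ha hb v hv
    simp [map_add, ha v hv, hb v hv]
  zero_mem' := by intro v hv; simp
  smul_mem' := by
    intro c f hf v hv
    simp [smul_eq_mul, map_mul, hf v hv]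

/-- Projective space `ℙ^n = ℙ(ℂ^ι)`. -/
abbrev Pn (ι : Type) [Fintype ι] := Projectivization ℂ (ι → ℂ)

/-- The reciprocal linear space `ℛ_L ⊂ ℙ^n`, the Zariski closure of `im φ`. -/
def RL (L : Matrix (Fin (d+1)) ι ℂ) : Set (Pn ι) :=
  {p | p.rep ∈ zarClosure ℂ (coneImage L)}

/-- The linear space `𝕃_u = {y : A^⊤ diag(u) y = 0} ⊂ ℙ^n`. -/
def LuSet (L : Matrix (Fin (d+1)) ι ℂ) (u : ι → ℂ) : Set (Pn ι) :=
  {p | ∀ k : Fin d, ∑ i : ι, L k.succ i * u i * p.rep i = 0}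

/-- The torus orbit `U_I = {y ∈ ℙ^n : y_i ≠ 0 ⇔ i ∈ I}`. -/
def Ustratum (I : Set ι) : Set (Pn ι) := {p : Pn ι | ∀ i : ι, p.rep i ≠ 0 ↔ i ∈ I}

/-- `p = φ(x)` for the map `φ : x ↦ (ℓ_0(x)⁻¹ : ⋯ : ℓ_n(x)⁻¹)`. -/
def PhiRel (L : Matrix (Fin (d+1)) ι ℂ) (x : Fin d → ℂ) (p : Pn ι) : Prop :=
  ∃ hv : (fun i => (ell ℂ L x i)⁻¹) ≠ 0, p = Projectivization.mk ℂ (fun i => (ell ℂ L x i)⁻¹) hv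

/-- The image of `φ` in `ℙ^n`. -/
def imPhi (L : Matrix (Fin (d+1)) ι ℂ) : Set (Pn ι) :=
  {p | ∃ x ∈ complementX L, PhiRel L x p}

/-- Complement of the subarrangement `𝒜_I`. -/
def subComplement (L : Matrix (Fin (d+1)) ι ℂ) (I : Set ι) : Set (Fin d → ℂ) :=
  {x | ∀ i ∈ I, ell ℂ L x i ≠ 0}

/-- The affine cone over the image of the reciprocal map of the subarrangement indexed by `I`,
embedded in the coordinate subspace `{y_i = 0, i ∉ I}`. -/
def coneImageSub (L : Matrix (Fin (d+1)) ι ℂ) (I : Set ι) : Set (ι → ℂ) :=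
  {v | ∃ (c : ℂ) (x : Fin d → ℂ), x ∈ subComplement L I ∧
      v = I.indicator (fun i => c / ell ℂ L x i)}

/-- The reciprocal linear space `ℛ_{L_I}` of the submatrix `L_I`, embedded in `ℙ^n`. -/
def RLsub (L : Matrix (Fin (d+1)) ι ℂ) (I : Set ι) : Set (Pn ι) :=
  {p | p.rep ∈ zarClosure ℂ (coneImageSub L I)}

/-- The open stratum `ℛ_{L_I}^∘ = ℛ_{L_I} ∩ U_I`. -/
def RLsubOpen (L : Matrix (Fin (d+1)) ι ℂ) (I : Set ι) : Set (Pn ι) :=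
  RLsub L I ∩ Ustratum I

/- ## The very affine variety `X_I = (ℂ^d ∖ 𝒜_I)/K_I` -/

/-- Quotient of `ℂ^d ∖ 𝒜_I` by translation by the left kernel `K_I` of `A_I^⊤`:
two points are identified iff `A_I^⊤` takes the same values on them. -/
def XIsetoid (L : Matrix (Fin (d+1)) ι ℂ) (I : Set ι) : Setoid ↥(subComplement L I) where
  r x y := ∀ i ∈ I, ∑ k : Fin d, (x : Fin d → ℂ) k * L k.succ i
      = ∑ k : Fin d, (y : Fin d → ℂ) k * L k.succ i
  iseqv := ⟨fun _ _ _ => rfl, fun h i hi => (h i hi).symm, fun h1 h2 i hi => (h1 i hi).trans (h2 i hi)⟩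

/-- The very affine variety `X_I = (ℂ^d ∖ 𝒜_I)/K_I`. -/
def XI (L : Matrix (Fin (d+1)) ι ℂ) (I : Set ι) : Type := Quotient (XIsetoid L I)

instance (L : Matrix (Fin (d+1)) ι ℂ) (I : Set ι) : TopologicalSpace (XI L I) :=
  instTopologicalSpaceQuotient

/-- The complement of the arrangement, over a general field `K`. -/
def complementK (K : Type) [Field K] (L : Matrix (Fin (d+1)) ι K) : Set (Fin d → K) :=
  {x | ∀ i, ell K L x i ≠ 0}

/-- The affine cone over the image of the reciprocal map, over a general field `K`. -/
def coneImageK (K : Type) [Field K] (L : Matrix (Fin (d+1)) ι K) : Set (ι → K) :=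
  {v | ∃ (c : K) (x : Fin d → K), x ∈ complementK K L ∧ v = fun i => c / ell K L x i}

/- ## Hilbert functions, degree, Hilbert regularity -/

/-- The Hilbert function of the graded algebra `K[y]/I`:
`q ↦ dim_K (K[y]/I)_q`. -/
def hilb (K : Type) [Field K] (I : Ideal (MvPolynomial ι K)) (q : ℕ) : ℕ :=
  Module.finrank K ((MvPolynomial.homogeneousSubmodule ι K q).map
    (Ideal.Quotient.mkₐ K I).toLinearMap)

/-- `k` is the degree of the `d`-dimensional projective variety with homogeneous
coordinate ring `K[y]/I`: the Hilbert polynomial has degree `d` and leading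
coefficient `k/d!`. -/
def IsProjDegree (K : Type) [Field K] (I : Ideal (MvPolynomial ι K)) (d k : ℕ) : Prop :=
  ∃ P : Polynomial ℚ, (∃ N : ℕ, ∀ q : ℕ, N ≤ q → Polynomial.eval (q : ℚ) P = hilb K I q) ∧
    P.degree = (d : WithBot ℕ) ∧ P.leadingCoeff = (k : ℚ) / (Nat.factorial d : ℚ)

/-- The Hilbert function, extended by `0` to negative integers. -/
def HFZ (K : Type) [Field K] (I : Ideal (MvPolynomial ι K)) (q : ℤ) : ℕ :=
  if 0 ≤ q then hilb K I q.toNat else 0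

/-- The Hilbert regularity: the smallest degree from which the Hilbert function
agrees with a (necessarily unique) polynomial. -/
def HReg (K : Type) [Field K] (I : Ideal (MvPolynomial ι K)) : ℤ :=
  sInf {i : ℤ | ∃ P : Polynomial ℚ, ∀ q : ℤ, i ≤ q → Polynomial.eval (q : ℚ) P = HFZ K I q}

set_option linter.unusedSectionVars false
namespace RecLin
open MvPolynomial

variable {K : Type} [Field K] {σ : Type} [Fintype σ]

/-- Linear form with given coefficients. -/
def lin (c : σ → K) : MvPolynomial σ K := ∑ i, C (c i) * X i

/-- A property of coefficient vectors holds outside finitely many proper subspaces. -/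
def Gen (Q : (σ → K) → Prop) : Prop :=
  ∃ F : Finset (Submodule K (σ → K)), (∀ U ∈ F, U ≠ ⊤) ∧ ∀ c, (∀ U ∈ F, c ∉ U) → Q c

/-- The ideal is stable under taking homogeneous components. -/
def Hm (I : Ideal (MvPolynomial σ K)) : Prop :=
  ∀ f ∈ I, ∀ q, homogeneousComponent q f ∈ I

/-- `f` is a nonzerodivisor modulo `I`, tested on homogeneous elements. -/
def Nz (I : Ideal (MvPolynomial σ K)) (f : MvPolynomial σ K) : Prop :=
  ∀ q g, g ∈ homogeneousSubmodule σ K q → f * g ∈ I → g ∈ I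

/-- Generic linear sections form a regular sequence of length `e`, with artinian
reduction vanishing in degrees at least `r`. -/
def PP : ℕ → ℕ → Ideal (MvPolynomial σ K) → Prop
  | 0, r, I => ∀ q, r ≤ q → ∀ f ∈ homogeneousSubmodule σ K q, f ∈ I
  | e + 1, r, I => Gen fun c => Nz I (lin c) ∧ PP e r (I ⊔ Ideal.span {lin c})

/-- All forms of large degree lie in the ideal. -/
def Ev (I : Ideal (MvPolynomial σ K)) : Prop :=
  ∃ N, ∀ q, N ≤ q → ∀ f ∈ homogeneousSubmodule σ K q, f ∈ I

theorem Gen.mono {Q R : (σ → K) → Prop} (h : Gen Q) (hQR : ∀ c, Q c → R c) : Gen R := by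
  obtain ⟨F, hF, h⟩ := h
  exact ⟨F, hF, fun c hc => hQR c (h c hc)⟩

theorem Gen.and {Q R : (σ → K) → Prop} (h : Gen Q) (h' : Gen R) : Gen fun c => Q c ∧ R c := by
  classical
  obtain ⟨F, hF, h⟩ := h
  obtain ⟨F', hF', h'⟩ := h'
  refine ⟨F ∪ F', ?_, fun c hc => ⟨h c fun U hU => hc U (by simp [hU]),
    h' c fun U hU => hc U (by simp [hU])⟩⟩
  intro U hU
  rcases Finset.mem_union.1 hU with h | h
  exacts [hF U h, hF' U h]

theorem Gen.exists [Infinite K] {Q : (σ → K) → Prop} (h : Gen Q) : ∃ c, Q c := by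
  obtain ⟨F, hF, h⟩ := h
  by_contra hcon
  push Not at hcon
  refine Subspace.biUnion_ne_univ_of_top_notMem (s := F) (fun ht => hF _ ht rfl) ?_
  ext c
  simp only [Set.mem_iUnion, Set.mem_univ, iff_true]
  by_contra hc
  push Not at hc
  exact hcon c (h c fun U hU => hc U hU)

theorem lin_mem (c : σ → K) : lin c ∈ homogeneousSubmodule σ K 1 := by
  unfold lin
  exact Submodule.sum_mem _ fun i _ => isHomogeneous_C_mul_X _ _

theorem comp_mul {k : ℕ} {f : MvPolynomial σ K} (hf : f ∈ homogeneousSubmodule σ K k)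
    (a : MvPolynomial σ K) (q : ℕ) :
    homogeneousComponent (q + k) (f * a) = f * homogeneousComponent q a := by
  classical
  conv_lhs => rw [← sum_homogeneousComponent a, Finset.mul_sum, map_sum]
  have : ∀ i, homogeneousComponent (q + k) (f * homogeneousComponent i a)
      = if i = q then f * homogeneousComponent q a else 0 := by
    intro i
    have hm : f * homogeneousComponent i a ∈ homogeneousSubmodule σ K (i + k) := by
      rw [add_comm]
      exact IsHomogeneous.mul hf (homogeneousComponent_isHomogeneous i a)
    rw [homogeneousComponent_of_mem hm]
    by_cases h : i = q
    · subst h; simp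
    · rw [if_neg h, if_neg]; omega
  simp only [this]
  rw [Finset.sum_ite_eq']
  split_ifs with h
  · rfl
  · rw [homogeneousComponent_eq_zero, mul_zero]
    simp at h; omega

theorem comp_mul_lt {k : ℕ} {f : MvPolynomial σ K} (hf : f ∈ homogeneousSubmodule σ K k)
    (a : MvPolynomial σ K) (q : ℕ) (hq : q < k) :
    homogeneousComponent q (f * a) = 0 := by
  conv_lhs => rw [← sum_homogeneousComponent a, Finset.mul_sum, map_sum]
  refine Finset.sum_eq_zero fun i _ => ?_
  have hm : f * homogeneousComponent i a ∈ homogeneousSubmodule σ K (k + i) :=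
    IsHomogeneous.mul hf (homogeneousComponent_isHomogeneous i a)
  rw [homogeneousComponent_of_mem hm, if_neg]; omega

theorem Hm.sup_span {I : Ideal (MvPolynomial σ K)} (hI : Hm I) {k : ℕ} {f : MvPolynomial σ K}
    (hf : f ∈ homogeneousSubmodule σ K k) : Hm (I ⊔ Ideal.span {f}) := by
  intro g hg q
  obtain ⟨i, hi, y, hy, rfl⟩ := Submodule.mem_sup.1 hg
  obtain ⟨a, rfl⟩ := Ideal.mem_span_singleton'.1 hy
  rw [map_add]
  refine add_mem (Ideal.mem_sup_left (hI i hi q)) (Ideal.mem_sup_right ?_)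
  rw [mul_comm]
  by_cases h : q < k
  · rw [comp_mul_lt hf _ _ h]; exact zero_mem _
  · obtain ⟨p, rfl⟩ := Nat.exists_eq_add_of_le' (not_lt.1 h)
    rw [comp_mul hf]
    exact Ideal.mul_mem_right _ _ (Ideal.mem_span_singleton_self f)

theorem mem_sup_hom {I : Ideal (MvPolynomial σ K)} (hI : Hm I) {k : ℕ} {f : MvPolynomial σ K}
    (hf : f ∈ homogeneousSubmodule σ K k) {q : ℕ} {g : MvPolynomial σ K}
    (hg : g ∈ homogeneousSubmodule σ K (q + k)) (h : g ∈ I ⊔ Ideal.span {f}) :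
    ∃ a ∈ homogeneousSubmodule σ K q, g - f * a ∈ I := by
  obtain ⟨i, hi, y, hy, rfl⟩ := Submodule.mem_sup.1 h
  obtain ⟨a, rfl⟩ := Ideal.mem_span_singleton'.1 hy
  refine ⟨homogeneousComponent q a, homogeneousComponent_mem _ _, ?_⟩
  have := homogeneousComponent_of_mem (m := q + k) hg
  rw [if_pos rfl, map_add, mul_comm a, comp_mul hf] at this
  rw [mul_comm a, ← this]
  simpa using hI i hi (q + k)

theorem mem_sup_hom_lt {I : Ideal (MvPolynomial σ K)} (hI : Hm I) {k : ℕ} {f : MvPolynomial σ K}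
    (hf : f ∈ homogeneousSubmodule σ K k) {q : ℕ} {g : MvPolynomial σ K}
    (hg : g ∈ homogeneousSubmodule σ K q) (hq : q < k) (h : g ∈ I ⊔ Ideal.span {f}) :
    g ∈ I := by
  obtain ⟨i, hi, y, hy, rfl⟩ := Submodule.mem_sup.1 h
  obtain ⟨a, rfl⟩ := Ideal.mem_span_singleton'.1 hy
  have := homogeneousComponent_of_mem (m := q) hg
  rw [if_pos rfl, map_add, mul_comm a, comp_mul_lt hf _ _ hq, add_zero] at this
  rw [mul_comm a, ← this]
  exact hI i hi q

theorem mem_sup_of_sub {I : Ideal (MvPolynomial σ K)} {f g a : MvPolynomial σ K}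
    (h : g - f * a ∈ I) : g ∈ I ⊔ Ideal.span {f} := by
  have : g = (g - f * a) + f * a := by ring
  rw [this]
  exact add_mem (Ideal.mem_sup_left h)
    (Ideal.mem_sup_right (Ideal.mul_mem_right _ _ (Ideal.mem_span_singleton_self f)))

theorem Nz.pow {I : Ideal (MvPolynomial σ K)} {k : ℕ} {f : MvPolynomial σ K}
    (hf : f ∈ homogeneousSubmodule σ K k) (h : Nz I f) (N : ℕ) : Nz I (f ^ N) := by
  induction N with
  | zero => intro q g _ hg; simpa using hg
  | succ N ih =>
    intro q g hg hfg
    refine h q g hg (ih (k + q) (f * g) (IsHomogeneous.mul hf hg) ?_)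
    rwa [pow_succ, mul_assoc] at hfg

/-- Exchange lemma for homogeneous regular sequences of length two. -/
theorem swap {I : Ideal (MvPolynomial σ K)} (hI : Hm I) {k l : ℕ} {a b : MvPolynomial σ K}
    (ha : a ∈ homogeneousSubmodule σ K (k + 1)) (hb : b ∈ homogeneousSubmodule σ K l)
    (h1 : Nz I a) (h2 : Nz (I ⊔ Ideal.span {a}) b) :
    Nz I b ∧ Nz (I ⊔ Ideal.span {b}) a := by
  have key : Nz I b := by
    intro q
    induction q using Nat.strong_induction_on with
    | _ q ih =>
      intro g hg hbg
      have hg2 := h2 q g hg (Ideal.mem_sup_left hbg)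
      by_cases hq : q < k + 1
      · exact mem_sup_hom_lt hI ha hg hq hg2
      · obtain ⟨p, rfl⟩ := Nat.exists_eq_add_of_le' (not_lt.1 hq)
        obtain ⟨u, hu, hgu⟩ := mem_sup_hom hI ha hg hg2
        have h3 : a * (b * u) ∈ I := by
          have : a * (b * u) = b * g - b * (g - a * u) := by ring
          rw [this]
          exact sub_mem hbg (Ideal.mul_mem_left _ _ hgu)
        have h4 := ih p (by omega) u hu (h1 _ _ (IsHomogeneous.mul hb hu) h3)
        have : g = (g - a * u) + a * u := by ring
        rw [this]
        exact add_mem hgu (Ideal.mul_mem_left _ _ h4)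
  refine ⟨key, ?_⟩
  intro q g hg hag
  have hagh : a * g ∈ homogeneousSubmodule σ K ((k + 1) + q) := IsHomogeneous.mul ha hg
  by_cases hq : (k + 1) + q < l
  · exact Ideal.mem_sup_left (h1 q g hg (mem_sup_hom_lt hI hb hagh hq hag))
  · obtain ⟨p, hp⟩ := Nat.exists_eq_add_of_le' (not_lt.1 hq)
    rw [hp] at hagh
    obtain ⟨u, hu, hagu⟩ := mem_sup_hom hI hb hagh hag
    -- b * u ∈ I + a
    have h3 : b * u ∈ I ⊔ Ideal.span {a} := by
      have : b * u = -(a * g - b * u) + a * g := by ring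
      rw [this]
      exact add_mem (Ideal.mem_sup_left (neg_mem hagu))
        (Ideal.mem_sup_right (Ideal.mul_mem_right _ _ (Ideal.mem_span_singleton_self a)))
    have h4 := h2 p u hu h3
    by_cases hq2 : p < k + 1
    · have h5 := mem_sup_hom_lt hI ha hu hq2 h4
      refine Ideal.mem_sup_left (h1 q g hg ?_)
      have : a * g = (a * g - b * u) + b * u := by ring
      rw [this]
      exact add_mem hagu (Ideal.mul_mem_left _ _ h5)
    · obtain ⟨s, rfl⟩ := Nat.exists_eq_add_of_le' (not_lt.1 hq2)
      obtain ⟨w, hw, huw⟩ := mem_sup_hom hI ha hu h4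
      have hql : q = s + l := by omega
      have h6 : a * (g - b * w) ∈ I := by
        have : a * (g - b * w) = (a * g - b * u) + b * (u - a * w) := by ring
        rw [this]
        exact add_mem hagu (Ideal.mul_mem_left _ _ huw)
      have hbw : b * w ∈ homogeneousSubmodule σ K q := by
        rw [hql, add_comm]; exact IsHomogeneous.mul hb hw
      exact mem_sup_of_sub (h1 q _ (sub_mem hg hbw) h6)

/-- Generic linear forms are nonzerodivisors in large degree. -/
theorem gen_large (J : Ideal (MvPolynomial σ K)) :
    Gen fun c => ∃ N, ∀ q, N ≤ q → ∀ f ∈ homogeneousSubmodule σ K q, lin c * f ∈ J → f ∈ J := by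
  classical
  obtain ⟨s, hs, hprim⟩ := Submodule.isLasker (MvPolynomial σ K) (MvPolynomial σ K) J
  let linL : (σ → K) →ₗ[K] MvPolynomial σ K :=
    ∑ i, (LinearMap.toSpanSingleton K _ (X i : MvPolynomial σ K)).comp (LinearMap.proj i)
  have hlinL : ∀ c, linL c = lin c := by
    intro c
    simp [linL, lin, LinearMap.sum_apply, MvPolynomial.smul_eq_C_mul]
  let U : Ideal (MvPolynomial σ K) → Submodule K (σ → K) := fun Q =>
    (Q.radical.restrictScalars K).comap linL
  have hU : ∀ Q c, c ∈ U Q ↔ lin c ∈ Q.radical := by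
    intro Q c
    simp [U, hlinL]
  refine ⟨(s.image U).filter (· ≠ ⊤), fun V hV => (Finset.mem_filter.1 hV).2, ?_⟩
  intro c hc
  have h1 : ∀ Q ∈ s, ∃ N, ∀ q, N ≤ q → ∀ f ∈ homogeneousSubmodule σ K q,
      lin c * f ∈ Q → f ∈ Q := by
    intro Q hQ
    by_cases htop : U Q = ⊤
    · have hX : Ideal.span (Set.range (X : σ → MvPolynomial σ K)) ≤ Ideal.radical Q := by
        rw [Ideal.span_le]
        rintro _ ⟨i, rfl⟩
        have : Pi.single i (1 : K) ∈ U Q := by rw [htop]; trivial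
        rw [hU] at this
        have h2 : lin (Pi.single i (1 : K)) = (X i : MvPolynomial σ K) := by
          unfold lin
          rw [Finset.sum_eq_single i]
          · simp
          · intro j _ hj; simp [hj]
          · simp
        rw [h2] at this
        exact this
      obtain ⟨N, hN⟩ := Ideal.exists_pow_le_of_le_radical_of_fg hX
        (Submodule.fg_span (Set.finite_range _))
      refine ⟨N, fun q hq f hf _ => hN (Ideal.pow_le_pow_right hq ?_)⟩
      rw [Ideal.mem_span_pow_iff_exists_isHomogeneous]
      exact ⟨MvPolynomial.map C f, IsHomogeneous.map hf _, by rw [MvPolynomial.eval_map, eval₂_eta]⟩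
    · refine ⟨0, fun q _ f _ hf => ?_⟩
      have hcU := hc (U Q) (Finset.mem_filter.2 ⟨Finset.mem_image_of_mem _ hQ, htop⟩)
      rw [hU] at hcU
      have := (Ideal.isPrimary_iff.1 (hprim hQ)).2 (x := f) (y := lin c) (by rwa [mul_comm])
      exact this.resolve_right hcU
  choose! N hN using h1
  refine ⟨s.sup N, fun q hq f hf hfJ => ?_⟩
  rw [← hs] at hfJ ⊢
  simp only [Submodule.mem_finsetInf, id] at hfJ ⊢
  exact fun Q hQ => hN Q hQ q ((Finset.le_sup hQ).trans hq) f hf (hfJ Q hQ)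

end RecLin

namespace RecLin
open MvPolynomial

variable {K : Type} [Field K] {σ : Type} [Fintype σ]

/-- Degree `q` piece of the quotient. -/
def Vq (I : Ideal (MvPolynomial σ K)) (q : ℕ) : Submodule K (MvPolynomial σ K ⧸ I) :=
  (homogeneousSubmodule σ K q).map (Ideal.Quotient.mkₐ K I).toLinearMap

/-- Hilbert function. -/
def hf (I : Ideal (MvPolynomial σ K)) (q : ℕ) : ℕ := Module.finrank K (Vq I q)

instance (I : Ideal (MvPolynomial σ K)) (q : ℕ) : Module.Finite K (Vq I q) := by
  have : Module.Finite K (homogeneousSubmodule σ K q) :=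
    Module.Finite.iff_fg.2 (homogeneousSubmodule_fg σ K q)
  unfold Vq
  infer_instance

theorem mem_Vq {I : Ideal (MvPolynomial σ K)} {q : ℕ} {f : MvPolynomial σ K}
    (hf : f ∈ homogeneousSubmodule σ K q) : Ideal.Quotient.mk I f ∈ Vq I q :=
  ⟨f, hf, rfl⟩

/-- Multiplication by a form. -/
def mulMap (I : Ideal (MvPolynomial σ K)) {k : ℕ} {f : MvPolynomial σ K}
    (hf : f ∈ homogeneousSubmodule σ K k) (q : ℕ) : Vq I q →ₗ[K] Vq I (q + k) :=
  (LinearMap.mulLeft K (Ideal.Quotient.mk I f)).restrict (by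
    rintro _ ⟨g, hg, rfl⟩
    refine ⟨f * g, ?_, by simp⟩
    rw [add_comm]
    exact IsHomogeneous.mul hf hg)

theorem mulMap_inj {I : Ideal (MvPolynomial σ K)} {k : ℕ} {f : MvPolynomial σ K}
    (hf : f ∈ homogeneousSubmodule σ K k) (q : ℕ) :
    Function.Injective (mulMap I hf q) ↔
      ∀ g ∈ homogeneousSubmodule σ K q, f * g ∈ I → g ∈ I := by
  rw [injective_iff_map_eq_zero]
  constructor
  · intro h g hg hfg
    have := h ⟨Ideal.Quotient.mk I g, mem_Vq hg⟩ (by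
      apply Subtype.ext
      change Ideal.Quotient.mk I f * Ideal.Quotient.mk I g = 0
      rw [← map_mul]; exact Ideal.Quotient.eq_zero_iff_mem.2 hfg)
    exact Ideal.Quotient.eq_zero_iff_mem.1 (congrArg Subtype.val this)
  · rintro h ⟨_, g, hg, rfl⟩ h0
    have h1 : Ideal.Quotient.mk I f * Ideal.Quotient.mk I g = 0 := congrArg Subtype.val h0
    rw [← map_mul] at h1
    apply Subtype.ext
    exact Ideal.Quotient.eq_zero_iff_mem.2 (h g hg (Ideal.Quotient.eq_zero_iff_mem.1 h1))

theorem mulMap_surj {I : Ideal (MvPolynomial σ K)} (hI : Hm I) {k : ℕ} {f : MvPolynomial σ K}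
    (hf : f ∈ homogeneousSubmodule σ K k) (q : ℕ) :
    Function.Surjective (mulMap I hf q) ↔
      ∀ g ∈ homogeneousSubmodule σ K (q + k), g ∈ I ⊔ Ideal.span {f} := by
  constructor
  · intro h g hg
    obtain ⟨⟨_, a, ha, rfl⟩, hx⟩ := h ⟨Ideal.Quotient.mk I g, mem_Vq hg⟩
    have h1 : Ideal.Quotient.mk I f * Ideal.Quotient.mk I a = Ideal.Quotient.mk I g :=
      congrArg Subtype.val hx
    rw [← map_mul] at h1
    exact mem_sup_of_sub (Ideal.Quotient.eq.1 h1.symm)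
  · rintro h ⟨_, g, hg, rfl⟩
    obtain ⟨a, ha, hga⟩ := mem_sup_hom hI hf hg (h g hg)
    refine ⟨⟨_, mem_Vq ha⟩, ?_⟩
    apply Subtype.ext
    change Ideal.Quotient.mk I f * Ideal.Quotient.mk I a = Ideal.Quotient.mk I g
    rw [← map_mul]
    exact (Ideal.Quotient.eq.2 hga).symm

theorem hf_le {I : Ideal (MvPolynomial σ K)} {k : ℕ} {f : MvPolynomial σ K}
    (hf' : f ∈ homogeneousSubmodule σ K k) {q : ℕ}
    (h : ∀ g ∈ homogeneousSubmodule σ K q, f * g ∈ I → g ∈ I) : hf I q ≤ hf I (q + k) :=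
  LinearMap.finrank_le_finrank_of_injective ((mulMap_inj hf' q).2 h)

theorem hf_ge {I : Ideal (MvPolynomial σ K)} (hI : Hm I) {k : ℕ} {f : MvPolynomial σ K}
    (hf' : f ∈ homogeneousSubmodule σ K k) {q : ℕ}
    (h : ∀ g ∈ homogeneousSubmodule σ K (q + k), g ∈ I ⊔ Ideal.span {f}) :
    hf I (q + k) ≤ hf I q :=
  LinearMap.finrank_le_finrank_of_surjective (f := mulMap I hf' q) ((mulMap_surj hI hf' q).2 h)

theorem surj_of_inj {I : Ideal (MvPolynomial σ K)} (hI : Hm I) {k : ℕ} {f : MvPolynomial σ K}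
    (hf' : f ∈ homogeneousSubmodule σ K k) {q : ℕ} (he : hf I (q + k) ≤ hf I q)
    (h : ∀ g ∈ homogeneousSubmodule σ K q, f * g ∈ I → g ∈ I) :
    ∀ g ∈ homogeneousSubmodule σ K (q + k), g ∈ I ⊔ Ideal.span {f} := by
  rw [← mulMap_surj hI hf']
  have heq : Module.finrank K (Vq I q) = Module.finrank K (Vq I (q + k)) :=
    le_antisymm (hf_le hf' h) he
  have hinj : Function.Injective (mulMap I hf' q) := (mulMap_inj hf' q).2 h
  exact (LinearMap.injective_iff_surjective_of_finrank_eq_finrank (f := mulMap I hf' q) heq).1 hinj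

theorem inj_of_surj {I : Ideal (MvPolynomial σ K)} (hI : Hm I) {k : ℕ} {f : MvPolynomial σ K}
    (hf' : f ∈ homogeneousSubmodule σ K k) {q : ℕ} (he : hf I q ≤ hf I (q + k))
    (h : ∀ g ∈ homogeneousSubmodule σ K (q + k), g ∈ I ⊔ Ideal.span {f}) :
    ∀ g ∈ homogeneousSubmodule σ K q, f * g ∈ I → g ∈ I := by
  rw [← mulMap_inj hf']
  have heq : Module.finrank K (Vq I q) = Module.finrank K (Vq I (q + k)) :=
    le_antisymm he (hf_ge hI hf' h)
  have hsurj : Function.Surjective (mulMap I hf' q) := (mulMap_surj hI hf' q).2 h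
  exact (LinearMap.injective_iff_surjective_of_finrank_eq_finrank (f := mulMap I hf' q) heq).2 hsurj

theorem PP.mono {e r s : ℕ} (hrs : r ≤ s) {I : Ideal (MvPolynomial σ K)} (h : PP e r I) :
    PP e s I := by
  induction e generalizing I with
  | zero => exact fun q hq => h q (hrs.trans hq)
  | succ e ih => exact Gen.mono h fun c hc => ⟨hc.1, ih hc.2⟩

/-- A form that is injective in large degree and a linear nonzerodivisor: injective. -/
theorem Nz.of_large {I : Ideal (MvPolynomial σ K)} {f y : MvPolynomial σ K}
    (hy : y ∈ homogeneousSubmodule σ K 1) (hyn : Nz I y)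
    (h : ∃ N, ∀ q, N ≤ q → ∀ g ∈ homogeneousSubmodule σ K q, f * g ∈ I → g ∈ I) : Nz I f := by
  obtain ⟨N, hN⟩ := h
  intro q g hg hfg
  have hyN : y ^ N ∈ homogeneousSubmodule σ K N := by
    simpa using IsHomogeneous.pow hy N
  refine Nz.pow hy hyn N q g hg (hN (N + q) (by omega) _ (IsHomogeneous.mul hyN hg) ?_)
  have : f * (y ^ N * g) = y ^ N * (f * g) := by ring
  rw [this]
  exact Ideal.mul_mem_left _ _ hfg

theorem hf_const {I : Ideal (MvPolynomial σ K)} (hI : Hm I) {y : MvPolynomial σ K}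
    (hy : y ∈ homogeneousSubmodule σ K 1) (hyn : Nz I y) {r : ℕ}
    (h : PP 0 (r + 1) (I ⊔ Ideal.span {y})) {q : ℕ} (hq : r ≤ q) (k : ℕ) :
    hf I (q + k) = hf I q := by
  induction k with
  | zero => rfl
  | succ k ih =>
    rw [← ih, ← add_assoc]
    exact le_antisymm (hf_ge hI hy fun g hg => h _ (by omega) g hg)
      (hf_le hy (hyn _))

/-- Lifting the property along a linear nonzerodivisor. -/
theorem PP.lift {I : Ideal (MvPolynomial σ K)} (hI : Hm I) {y : MvPolynomial σ K}
    (hy : y ∈ homogeneousSubmodule σ K 1) (hyn : Nz I y) {e r : ℕ}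
    (h : PP e (r + 1) (I ⊔ Ideal.span {y})) : PP (e + 1) (r + 1) I := by
  induction e generalizing I with
  | zero =>
    refine Gen.mono (gen_large I) fun c hc => ?_
    have hn : Nz I (lin c) := Nz.of_large hy hyn hc
    refine ⟨hn, fun q hq f hf => ?_⟩
    obtain ⟨p, rfl⟩ := Nat.exists_eq_add_of_le' (show 1 ≤ q by omega)
    exact surj_of_inj hI (lin_mem c) (hf_const hI hy hyn h (by omega) 1).le (hn p) f hf
  | succ e ih =>
    refine Gen.mono h fun c hc => ?_
    obtain ⟨h1, h2⟩ := swap (k := 0) hI hy (lin_mem c) hyn hc.1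
    refine ⟨h1, ih (hI.sup_span (lin_mem c)) h2 ?_⟩
    rw [sup_right_comm]
    exact hc.2

variable [Infinite K]

/-- Cutting by a homogeneous nonzerodivisor. -/
theorem PP.cut {I : Ideal (MvPolynomial σ K)} (hI : Hm I) {k : ℕ} {f : MvPolynomial σ K}
    (hf' : f ∈ homogeneousSubmodule σ K k) (hfn : Nz I f) {e r : ℕ}
    (h : PP (e + 1) (r + 1) I) : PP e (r + k) (I ⊔ Ideal.span {f}) := by
  induction e generalizing I with
  | zero =>
    obtain ⟨c, hc, hc0⟩ := Gen.exists h
    intro q hq g hg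
    obtain ⟨p, rfl⟩ := Nat.exists_eq_add_of_le' (show k ≤ q by omega)
    exact surj_of_inj hI hf' (hf_const hI (lin_mem c) hc hc0 (by omega) k).le (hfn p) g hg
  | succ e ih =>
    refine Gen.mono (Gen.and h (gen_large (I ⊔ Ideal.span {f}))) ?_
    rintro c ⟨⟨hc, hP⟩, N, hN⟩
    set η := lin c with hη
    have hηm : η ∈ homogeneousSubmodule σ K 1 := lin_mem c
    obtain ⟨c2, hc2, -⟩ := Gen.exists hP
    have h2 : Nz (I ⊔ Ideal.span {η}) f := by
      intro q g hg hfg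
      have hfgm : f * g ∈ homogeneousSubmodule σ K (k + q) := IsHomogeneous.mul hf' hg
      rcases Nat.eq_zero_or_pos (k + q) with h0 | h0
      · rw [h0] at hfgm
        exact Ideal.mem_sup_left (hfn q g hg (mem_sup_hom_lt hI hηm hfgm one_pos hfg))
      obtain ⟨p, hp⟩ := Nat.exists_eq_add_of_le' (show 1 ≤ k + q by omega)
      rw [hp] at hfgm
      obtain ⟨w, hw, hfw⟩ := mem_sup_hom hI hηm hfgm hfg
      have hM := IsHomogeneous.pow (lin_mem c2) (N + k)
      set M := N + k with hMdef
      rw [one_mul] at hM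
      set z := lin c2 ^ M with hz
      have hzw : z * w ∈ homogeneousSubmodule σ K (M + p) := IsHomogeneous.mul hM hw
      have h3 : η * (z * w) ∈ I ⊔ Ideal.span {f} := by
        have : η * (z * w) - f * (z * g) = -(z * (f * g - η * w)) := by ring
        apply mem_sup_of_sub (a := z * g)
        rw [this]
        exact neg_mem (Ideal.mul_mem_left _ _ hfw)
      have h4 := hN (M + p) (by omega) _ hzw h3
      have hdeg : M + p = (N + p) + k := by omega
      rw [hdeg] at hzw
      obtain ⟨u, hu, hzu⟩ := mem_sup_hom hI hf' hzw h4
      have h5 : f * (z * g - η * u) ∈ I := by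
        have : f * (z * g - η * u) = z * (f * g - η * w) + η * (z * w - f * u) := by ring
        rw [this]
        exact add_mem (Ideal.mul_mem_left _ _ hfw) (Ideal.mul_mem_left _ _ hzu)
      have hzg : z * g ∈ homogeneousSubmodule σ K (M + q) := IsHomogeneous.mul hM hg
      have hηu : η * u ∈ homogeneousSubmodule σ K (M + q) := by
        have : M + q = 1 + (N + p) := by omega
        rw [this]
        exact IsHomogeneous.mul hηm hu
      have h6 := hfn _ _ (sub_mem hzg hηu) h5
      exact Nz.pow (lin_mem c2) hc2 M q g hg (mem_sup_of_sub h6)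
    obtain ⟨-, h3⟩ := swap (k := 0) hI hηm hf' hc h2
    refine ⟨h3, ?_⟩
    rw [sup_right_comm]
    exact ih (hI.sup_span hηm) h2 hP

/-- Avoidance: cutting by a generic linear form instead of `g`. -/
theorem gen_ev {J : Ideal (MvPolynomial σ K)} (hJ : Hm J) {k : ℕ} {g : MvPolynomial σ K}
    (hg : g ∈ homogeneousSubmodule σ K (k + 1)) (h : Ev (J ⊔ Ideal.span {g})) :
    Gen fun c => Ev (J ⊔ Ideal.span {lin c}) := by
  obtain ⟨M, hM⟩ := h
  refine Gen.mono (gen_large J) ?_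
  rintro c ⟨N, hN⟩
  refine ⟨N + M + 1, fun q hq f hf' => ?_⟩
  obtain ⟨p, rfl⟩ := Nat.exists_eq_add_of_le' (show 1 ≤ q by omega)
  have mono : ∀ j, hf J (p + 1) ≤ hf J (p + 1 + j) := by
    intro j
    induction j with
    | zero => rfl
    | succ j ih => exact ih.trans (hf_le (lin_mem c) (hN _ (by omega)))
  refine surj_of_inj hJ (lin_mem c) ?_ (hN p (by omega)) f hf'
  calc hf J (p + 1) ≤ hf J (p + 1 + k) := mono k
    _ = hf J (p + (k + 1)) := by congr 1; omega
    _ ≤ hf J p := hf_ge hJ hg (hM _ (by omega))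

theorem hm_sup_list {I : Ideal (MvPolynomial σ K)} (hI : Hm I) (gs : List (MvPolynomial σ K))
    (hgs : ∀ g ∈ gs, ∃ k, g ∈ homogeneousSubmodule σ K (k + 1)) :
    Hm (I ⊔ Ideal.span {g | g ∈ gs}) := by
  induction gs generalizing I with
  | nil => simpa using hI
  | cons g gs ih =>
    obtain ⟨k, hk⟩ := hgs g (by simp)
    have : I ⊔ Ideal.span {x | x ∈ g :: gs} = (I ⊔ Ideal.span {g}) ⊔ Ideal.span {x | x ∈ gs} := by
      rw [sup_assoc, ← Ideal.span_union]
      congr 2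
      ext x; simp
    rw [this]
    exact ih (hI.sup_span hk) fun x hx => hgs x (by simp [hx])

theorem Ev.mono {I J : Ideal (MvPolynomial σ K)} (h : I ≤ J) (hI : Ev I) : Ev J := by
  obtain ⟨N, hN⟩ := hI
  exact ⟨N, fun q hq f hf => h (hN q hq f hf)⟩

/-- Members of a homogeneous system of parameters are nonzerodivisors. -/
theorem PP.nz {I : Ideal (MvPolynomial σ K)} (hI : Hm I) {k r : ℕ} {f : MvPolynomial σ K}
    (hf' : f ∈ homogeneousSubmodule σ K (k + 1)) (gs : List (MvPolynomial σ K))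
    (hgs : ∀ g ∈ gs, ∃ k, g ∈ homogeneousSubmodule σ K (k + 1))
    (h : PP (gs.length + 1) (r + 1) I)
    (hev : Ev (I ⊔ Ideal.span {f} ⊔ Ideal.span {g | g ∈ gs})) : Nz I f := by
  induction gs generalizing I with
  | nil =>
    obtain ⟨c, hc, hc0⟩ := Gen.exists h
    obtain ⟨N, hN⟩ := hev
    refine Nz.of_large (lin_mem c) hc ⟨N + r, fun q hq => ?_⟩
    refine inj_of_surj hI hf' (hf_const hI (lin_mem c) hc hc0 (by omega) _).ge ?_
    intro g hg
    have := hN _ (by omega) g hg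
    simpa using this
  | cons g gs ih =>
    obtain ⟨l, hl⟩ := hgs g (by simp)
    have hgs' : ∀ x ∈ gs, ∃ k, x ∈ homogeneousSubmodule σ K (k + 1) :=
      fun x hx => hgs x (by simp [hx])
    have e1 : ∀ I' : Ideal (MvPolynomial σ K), I' ⊔ Ideal.span {x | x ∈ g :: gs}
        = (I' ⊔ Ideal.span {x | x ∈ gs}) ⊔ Ideal.span {g} := by
      intro I'
      rw [sup_assoc, ← Ideal.span_union]
      congr 2
      ext x; simp
    rw [e1] at hev
    have hg := gen_ev (hm_sup_list (hI.sup_span hf') gs hgs') hl hev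
    obtain ⟨c, ⟨hc, hP⟩, hE⟩ := Gen.exists (Gen.and h hg)
    have := ih (hI.sup_span (lin_mem c)) hgs' hP (by
      refine Ev.mono (le_of_eq ?_) hE
      simp only [sup_assoc, sup_comm, sup_left_comm])
    exact (swap (k := 0) hI (lin_mem c) hf' hc this).1

/-- Vanishing of the artinian reduction. -/
theorem PP.vanish {I : Ideal (MvPolynomial σ K)} (hI : Hm I) {k r : ℕ} {h : MvPolynomial σ K}
    (hh : h ∈ homogeneousSubmodule σ K (k + 1)) (fs : List (MvPolynomial σ K))
    (hfs : ∀ g ∈ fs, g ∈ homogeneousSubmodule σ K 1)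
    (hP : PP (fs.length + 1) (r + 1) I)
    (hev : Ev (I ⊔ Ideal.span {g | g ∈ fs} ⊔ Ideal.span {h})) :
    PP 0 (r + (k + 1)) (I ⊔ Ideal.span {g | g ∈ fs} ⊔ Ideal.span {h}) := by
  induction fs generalizing I with
  | nil =>
    have e0 : I ⊔ Ideal.span {g : MvPolynomial σ K | g ∈ ([] : List (MvPolynomial σ K))} = I := by
      simp
    rw [e0] at hev ⊢
    have hn : Nz I h := PP.nz hI hh [] (by simp) hP (by simpa using hev)
    exact PP.cut hI hh hn hP
  | cons f fs ih =>
    have e1 : I ⊔ Ideal.span {x | x ∈ f :: fs}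
        = (I ⊔ Ideal.span {f}) ⊔ Ideal.span {x | x ∈ fs} := by
      rw [sup_assoc, ← Ideal.span_union]
      congr 2
      ext x; simp
    have hf1 := hfs f (by simp)
    have hfs' : ∀ g ∈ fs, g ∈ homogeneousSubmodule σ K 1 := fun x hx => hfs x (by simp [hx])
    rw [e1] at hev ⊢
    have hn : Nz I f := by
      refine PP.nz (k := 0) (r := r) hI hf1 (h :: fs) ?_ (by simpa using hP) ?_
      · intro g hg
        rcases List.mem_cons.1 hg with rfl | hg
        · exact ⟨k, hh⟩
        · exact ⟨0, hfs' g hg⟩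
      · refine Ev.mono (le_of_eq ?_) hev
        rw [sup_assoc _ (Ideal.span {x | x ∈ fs}), ← Ideal.span_union]
        congr 2
        ext x; simp
    exact ih (hI.sup_span hf1) hfs' (PP.cut (k := 1) hI hf1 hn hP) hev

end RecLin

namespace RecLin
open MvPolynomial

variable {K : Type} [Field K] {σ : Type} [Fintype σ]

theorem Hm.mem_of_comp {I : Ideal (MvPolynomial σ K)} {f : MvPolynomial σ K}
    (h : ∀ q, homogeneousComponent q f ∈ I) : f ∈ I := by
  rw [← sum_homogeneousComponent f]
  exact sum_mem fun i _ => h i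

theorem Nz.full {I : Ideal (MvPolynomial σ K)} (hI : Hm I) {k : ℕ} {f : MvPolynomial σ K}
    (hf : f ∈ homogeneousSubmodule σ K k) (h : Nz I f) {g : MvPolynomial σ K} (hg : f * g ∈ I) :
    g ∈ I := by
  refine Hm.mem_of_comp fun q => h q _ (homogeneousComponent_mem _ _) ?_
  rw [← comp_mul hf]
  exact hI _ hg _

theorem mem_sup_iff {I : Ideal (MvPolynomial σ K)} {f g : MvPolynomial σ K} :
    g ∈ I ⊔ Ideal.span {f} ↔ ∃ a, g - f * a ∈ I := by
  constructor
  · intro h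
    obtain ⟨i, hi, y, hy, rfl⟩ := Submodule.mem_sup.1 h
    obtain ⟨a, rfl⟩ := Ideal.mem_span_singleton'.1 hy
    exact ⟨a, by simpa [mul_comm a] using hi⟩
  · rintro ⟨a, h⟩
    exact mem_sup_of_sub h

/-- A degree one isomorphism between `J'/I` and `J/I`, given by its graph. -/
structure Cor (I J' J : Ideal (MvPolynomial σ K))
    (G : Submodule (MvPolynomial σ K) (MvPolynomial σ K × MvPolynomial σ K)) : Prop where
  le1 : I ≤ J'
  le2 : I ≤ J
  sub : ∀ p ∈ G, p.1 ∈ J' ∧ p.2 ∈ J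
  ex1 : ∀ f ∈ J', ∃ g, (f, g) ∈ G
  ex2 : ∀ g ∈ J, ∃ f, (f, g) ∈ G
  iff : ∀ p ∈ G, (p.1 ∈ I ↔ p.2 ∈ I)
  hom : ∀ p ∈ G, ∀ q, (homogeneousComponent q p.1, homogeneousComponent (q + 1) p.2) ∈ G

theorem Cor.cut {I J' J : Ideal (MvPolynomial σ K)}
    {G : Submodule (MvPolynomial σ K) (MvPolynomial σ K × MvPolynomial σ K)}
    (hC : Cor I J' J G) (hI : Hm I) (hJ' : Hm J') (hJ : Hm J) {η : MvPolynomial σ K}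
    (hη : η ∈ homogeneousSubmodule σ K 1) (h1 : Nz J' η) (h2 : Nz J η) :
    Cor (I ⊔ Ideal.span {η}) (J' ⊔ Ideal.span {η}) (J ⊔ Ideal.span {η})
      (G ⊔ Submodule.prod (I ⊔ Ideal.span {η}) (I ⊔ Ideal.span {η})) := by
  have hIη := hI.sup_span hη
  have exG : ∀ p ∈ G, (p.1 ∈ I ⊔ Ideal.span {η} ↔ p.2 ∈ I ⊔ Ideal.span {η}) := by
    rintro ⟨f, g⟩ hp
    constructor
    · intro h
      obtain ⟨a, ha⟩ := mem_sup_iff.1 h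
      have h3 : η * a ∈ J' := by
        have : η * a = f - (f - η * a) := by ring
        rw [this]; exact sub_mem (hC.sub _ hp).1 (hC.le1 ha)
      obtain ⟨b, hb⟩ := hC.ex1 a (h1.full hJ' hη h3)
      have h4 := G.sub_mem hp (G.smul_mem η hb)
      exact mem_sup_iff.2 ⟨b, (hC.iff _ h4).1 ha⟩
    · intro h
      obtain ⟨a, ha⟩ := mem_sup_iff.1 h
      have h3 : η * a ∈ J := by
        have : η * a = g - (g - η * a) := by ring
        rw [this]; exact sub_mem (hC.sub _ hp).2 (hC.le2 ha)
      obtain ⟨b, hb⟩ := hC.ex2 a (h2.full hJ hη h3)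
      have h4 := G.sub_mem hp (G.smul_mem η hb)
      exact mem_sup_iff.2 ⟨b, (hC.iff _ h4).2 ha⟩
  constructor
  · exact sup_le_sup_right hC.le1 _
  · exact sup_le_sup_right hC.le2 _
  · intro p hp
    obtain ⟨a, ha, b, hb, rfl⟩ := Submodule.mem_sup.1 hp
    exact ⟨add_mem (Ideal.mem_sup_left (hC.sub a ha).1) (sup_le_sup_right hC.le1 _ hb.1),
      add_mem (Ideal.mem_sup_left (hC.sub a ha).2) (sup_le_sup_right hC.le2 _ hb.2)⟩
  · intro f hf
    obtain ⟨a, ha⟩ := mem_sup_iff.1 hf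
    obtain ⟨g, hg⟩ := hC.ex1 _ ha
    refine ⟨g, Submodule.mem_sup.2 ⟨_, hg, (η * a, 0), ⟨?_, zero_mem _⟩, by simp⟩⟩
    exact Ideal.mem_sup_right (Ideal.mul_mem_right _ _ (Ideal.mem_span_singleton_self η))
  · intro f hf
    obtain ⟨a, ha⟩ := mem_sup_iff.1 hf
    obtain ⟨g, hg⟩ := hC.ex2 _ ha
    refine ⟨g, Submodule.mem_sup.2 ⟨_, hg, (0, η * a), ⟨zero_mem _, ?_⟩, by simp⟩⟩
    exact Ideal.mem_sup_right (Ideal.mul_mem_right _ _ (Ideal.mem_span_singleton_self η))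
  · intro p hp
    obtain ⟨a, ha, b, hb, rfl⟩ := Submodule.mem_sup.1 hp
    have := exG a ha
    rw [Prod.fst_add, Prod.snd_add]
    exact (Submodule.add_mem_iff_left _ hb.1).trans (this.trans
      (Submodule.add_mem_iff_left _ hb.2).symm)
  · intro p hp q
    obtain ⟨a, ha, b, hb, rfl⟩ := Submodule.mem_sup.1 hp
    refine Submodule.mem_sup.2 ⟨_, hC.hom a ha q,
      (homogeneousComponent q b.1, homogeneousComponent (q + 1) b.2), ⟨hIη _ hb.1 _, hIη _ hb.2 _⟩, ?_⟩
    simp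

variable [Infinite K]

theorem Cor.base {I J' J : Ideal (MvPolynomial σ K)}
    {G : Submodule (MvPolynomial σ K) (MvPolynomial σ K × MvPolynomial σ K)}
    (hC : Cor I J' J G) (hI : Hm I) {r : ℕ}
    (h1 : PP 1 (r + 1) I) (h2 : PP 0 r J') : PP 0 (r + 1) J := by
  obtain ⟨c, hc, hc0⟩ := Gen.exists h1
  intro q' hq' f hfm
  obtain ⟨q, rfl⟩ := Nat.exists_eq_add_of_le' (show 1 ≤ q' by omega)
  have hdim : hf I (q + 1) = hf I q := hf_const hI (lin_mem c) hc hc0 (by omega) 1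
  let Gq : Submodule K (MvPolynomial σ K × MvPolynomial σ K) :=
    G.restrictScalars K ⊓
      (homogeneousSubmodule σ K q).prod (homogeneousSubmodule σ K (q + 1))
  let π := (Ideal.Quotient.mkₐ K I).toLinearMap
  let A1 : Gq →ₗ[K] Vq I q :=
    ((π.comp (LinearMap.fst K _ _)).comp Gq.subtype).codRestrict _
      (fun x => mem_Vq x.2.2.1)
  let A2 : Gq →ₗ[K] Vq I (q + 1) :=
    ((π.comp (LinearMap.snd K _ _)).comp Gq.subtype).codRestrict _
      (fun x => mem_Vq x.2.2.2)
  have hA1 : ∀ x : Gq, A1 x = 0 ↔ x.1.1 ∈ I := by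
    intro x
    rw [← Subtype.val_inj]
    exact Ideal.Quotient.eq_zero_iff_mem
  have hA2 : ∀ x : Gq, A2 x = 0 ↔ x.1.2 ∈ I := by
    intro x
    rw [← Subtype.val_inj]
    exact Ideal.Quotient.eq_zero_iff_mem
  have hs : Function.Surjective A1 := by
    rintro ⟨_, g, hg, rfl⟩
    obtain ⟨u, hu⟩ := hC.ex1 g (h2 q (by omega) g hg)
    have := hC.hom _ hu q
    simp only at this
    rw [homogeneousComponent_of_mem hg, if_pos rfl] at this
    exact ⟨⟨_, this, hg, homogeneousComponent_mem _ _⟩, rfl⟩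
  obtain ⟨s, hs'⟩ := A1.exists_rightInverse_of_surjective (LinearMap.range_eq_top.2 hs)
  have hinj : Function.Injective (A2.comp s) := by
    rw [injective_iff_map_eq_zero]
    intro v hv
    have h3 : A1 (s v) = 0 := by
      rw [hA1, hC.iff _ (s v).2.1, ← hA2]; exact hv
    have := LinearMap.congr_fun hs' v
    simp only [LinearMap.comp_apply, LinearMap.id_apply] at this
    rw [← this, h3]
  have hfin : Module.finrank K (Vq I q) = Module.finrank K (Vq I (q + 1)) := hdim.symm
  have hsurj := (LinearMap.injective_iff_surjective_of_finrank_eq_finrank (f := A2.comp s) hfin).1 hinj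
  obtain ⟨v, hv⟩ := hsurj ⟨_, mem_Vq hfm⟩
  have h5 : Ideal.Quotient.mk I (s v).1.2 = Ideal.Quotient.mk I f := congrArg Subtype.val hv
  have h6 := hC.le2 (Ideal.Quotient.eq.1 h5)
  have h7 := (hC.sub _ (s v).2.1).2
  have : f = (s v).1.2 - ((s v).1.2 - f) := by ring
  rw [this]
  exact sub_mem h7 h6

theorem Cor.pp {e r : ℕ} {I J' J : Ideal (MvPolynomial σ K)}
    {G : Submodule (MvPolynomial σ K) (MvPolynomial σ K × MvPolynomial σ K)}
    (hC : Cor I J' J G) (hI : Hm I) (hJ' : Hm J') (hJ : Hm J)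
    (h1 : PP (e + 1) (r + 1) I) (h2 : PP e r J') : PP e (r + 1) J := by
  induction e generalizing I J' J G with
  | zero => exact hC.base hI h1 h2
  | succ e ih =>
    refine Gen.mono (Gen.and (Gen.and h1 h2) (gen_large J)) ?_
    rintro c ⟨⟨⟨hc, hP⟩, hc', hP'⟩, N, hN⟩
    set η := lin c with hη
    have hηm : η ∈ homogeneousSubmodule σ K 1 := lin_mem c
    obtain ⟨c2, hc2, -⟩ := Gen.exists hP
    have hz := IsHomogeneous.pow (lin_mem c2) N
    rw [one_mul] at hz
    have hzn := Nz.pow (lin_mem c2) hc2 N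
    set z := lin c2 ^ N
    have hn : Nz J η := by
      intro q f hf hηf
      have h3 : z * f ∈ J := by
        refine hN (N + q) (by omega) _ (IsHomogeneous.mul hz hf) ?_
        have : η * (z * f) = z * (η * f) := by ring
        rw [this]; exact Ideal.mul_mem_left _ _ hηf
      obtain ⟨j', hj'⟩ := hC.ex2 _ h3
      obtain ⟨u, hu⟩ := hC.ex2 _ hηf
      have h4 := G.sub_mem (G.smul_mem z hu) (G.smul_mem η hj')
      have h5 : z * u - η * j' ∈ I := by
        refine (hC.iff _ h4).2 ?_
        have : z * (η * f) - η * (z * f) = 0 := by ring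
        simp [this]
      have h6 : u ∈ I ⊔ Ideal.span {η} :=
        hzn.full (hI.sup_span hηm) hz (mem_sup_of_sub h5)
      obtain ⟨a, ha⟩ := mem_sup_iff.1 h6
      have h7 : η * a ∈ J' := by
        have : η * a = u - (u - η * a) := by ring
        rw [this]; exact sub_mem (hC.sub _ hu).1 (hC.le1 ha)
      obtain ⟨b, hb⟩ := hC.ex1 a (hc'.full hJ' hηm h7)
      have h8 := (hC.iff _ (G.sub_mem hu (G.smul_mem η hb))).1 ha
      have h9 : η * (f - b) ∈ I := by
        have : η * (f - b) = η * f - η * b := by ring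
        rw [this]; exact h8
      have h10 := hC.le2 (hc.full hI hηm h9)
      have : f = (f - b) + b := by ring
      rw [this]
      exact add_mem h10 (hC.sub _ hb).2
    exact ⟨hn, ih (hC.cut hI hJ' hJ hηm hc' hn) (hI.sup_span hηm) (hJ'.sup_span hηm)
      (hJ.sup_span hηm) hP hP'⟩

/-- Invariance under linear changes of coordinates. -/
theorem PP.comap {e r : ℕ} {I : Ideal (MvPolynomial σ K)}
    (φ : MvPolynomial σ K ≃ₐ[K] MvPolynomial σ K) (M : (σ → K) ≃ₗ[K] (σ → K))
    (hM : ∀ c, φ (lin c) = lin (M c))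
    (hφ : ∀ q f, f ∈ homogeneousSubmodule σ K q → φ f ∈ homogeneousSubmodule σ K q)
    (h : PP e r I) : PP e r (I.comap φ) := by
  induction e generalizing I with
  | zero => exact fun q hq f hf => h q hq _ (hφ q f hf)
  | succ e ih =>
    classical
    obtain ⟨F, hF, hG⟩ := h
    refine ⟨F.image (fun U => U.comap M.toLinearMap), ?_, ?_⟩
    · intro U hU
      obtain ⟨V, hV, rfl⟩ := Finset.mem_image.1 hU
      intro htop
      apply hF V hV
      rw [eq_top_iff]
      intro x _
      have : M.symm x ∈ V.comap M.toLinearMap := by rw [htop]; trivial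
      simpa using this
    · intro c hc
      obtain ⟨h1, h2⟩ := hG (M c) fun U hU hcU =>
        hc _ (Finset.mem_image_of_mem _ hU) hcU
      refine ⟨?_, ?_⟩
      · intro q g hg hcg
        refine h1 q (φ g) (hφ q g hg) ?_
        rw [← hM, ← map_mul]
        exact hcg
      · have : I.comap φ ⊔ Ideal.span {lin c} = (I ⊔ Ideal.span {lin (M c)}).comap φ := by
          ext g
          rw [mem_sup_iff, Ideal.mem_comap, mem_sup_iff]
          constructor
          · rintro ⟨a, ha⟩
            refine ⟨φ a, ?_⟩
            rw [← hM, ← map_mul, ← map_sub]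
            exact ha
          · rintro ⟨a, ha⟩
            refine ⟨φ.symm a, ?_⟩
            rw [Ideal.mem_comap, map_sub, map_mul, hM, AlgEquiv.apply_symm_apply]
            exact ha
        rw [this]
        exact ih h2

end RecLin

namespace RecLin
open MvPolynomial

section line
variable {K : Type} [Field K]

/-- Functions of one parameter that are rational and regular at zero. -/
def Reg (g : K → K) : Prop :=
  ∃ P Q : Polynomial K, Q.eval 0 ≠ 0 ∧ ∀ t, Q.eval t * g t = P.eval t

theorem Reg.poly (P : Polynomial K) : Reg fun t => P.eval t :=
  ⟨P, 1, by simp, by simp⟩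

theorem Reg.const (a : K) : Reg fun _ => a :=
  ⟨Polynomial.C a, 1, by simp, by simp⟩

theorem Reg.aff (a b : K) : Reg fun t => a + t * b :=
  ⟨Polynomial.C a + Polynomial.X * Polynomial.C b, 1, by simp,
    fun t => by simp; ring⟩

theorem Reg.add {f g : K → K} (hf : Reg f) (hg : Reg g) : Reg fun t => f t + g t := by
  obtain ⟨P, Q, hQ, h⟩ := hf
  obtain ⟨P', Q', hQ', h'⟩ := hg
  refine ⟨P * Q' + P' * Q, Q * Q', by simp [hQ, hQ'], fun t => ?_⟩
  simp only [Polynomial.eval_mul, Polynomial.eval_add, ← h, ← h']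
  ring

theorem Reg.mul {f g : K → K} (hf : Reg f) (hg : Reg g) : Reg fun t => f t * g t := by
  obtain ⟨P, Q, hQ, h⟩ := hf
  obtain ⟨P', Q', hQ', h'⟩ := hg
  refine ⟨P * P', Q * Q', by simp [hQ, hQ'], fun t => ?_⟩
  simp only [Polynomial.eval_mul, ← h, ← h']
  ring

theorem Reg.pow {f : K → K} (hf : Reg f) (n : ℕ) : Reg fun t => f t ^ n := by
  induction n with
  | zero => simpa using Reg.const 1
  | succ n ih => simpa only [pow_succ] using ih.mul hf

theorem Reg.inv {a : K} (ha : a ≠ 0) (b : K) : Reg fun t => (a + t * b)⁻¹ := by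
  refine ⟨Polynomial.C a + Polynomial.X * Polynomial.C b,
    (Polynomial.C a + Polynomial.X * Polynomial.C b) ^ 2, by simp [ha], fun t => ?_⟩
  simp only [Polynomial.eval_pow, Polynomial.eval_add, Polynomial.eval_C, Polynomial.eval_mul,
    Polynomial.eval_X]
  by_cases h : a + t * b = 0
  · simp [h]
  · field_simp

theorem Reg.zero [Infinite K] {g : K → K} (hg : Reg g) {S : Set K} (hS : S.Finite)
    (h : ∀ t, t ∉ S → g t = 0) : g 0 = 0 := by
  obtain ⟨P, Q, hQ, hPQ⟩ := hg
  have hP : P = 0 := by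
    refine Polynomial.eq_zero_of_infinite_isRoot P (hS.infinite_compl.mono ?_)
    intro t ht
    have := hPQ t
    rw [h t ht, mul_zero] at this
    exact this.symm
  have := hPQ 0
  rw [hP, Polynomial.eval_zero] at this
  exact (mul_eq_zero.1 this).resolve_left hQ

end line

variable {K : Type} [Field K] {σ : Type} [Fintype σ] [DecidableEq σ]
  {V : Type} [AddCommGroup V] [Module K V] (ℓ : σ → Module.Dual K V)

/-- The reciprocal point. -/
def vA (A : Finset σ) (x : V) : σ → K := fun i => if i ∈ A then (ℓ i x)⁻¹ else 0

/-- The ideal of the (partial) reciprocal linear space. -/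
def Iv (A : Finset σ) (W : Submodule K V) : Ideal (MvPolynomial σ K) where
  carrier := {f | ∀ x ∈ W, (∀ i ∈ A, ℓ i x ≠ 0) → eval (vA ℓ A x) f = 0}
  add_mem' := by
    intro a b ha hb x hx h
    rw [map_add, ha x hx h, hb x hx h, add_zero]
  zero_mem' := by intro x _ _; simp
  smul_mem' := by
    intro c f hf x hx h
    rw [smul_eq_mul, map_mul, hf x hx h, mul_zero]

theorem mem_Iv {A : Finset σ} {W : Submodule K V} {f : MvPolynomial σ K} :
    f ∈ Iv ℓ A W ↔ ∀ x ∈ W, (∀ i ∈ A, ℓ i x ≠ 0) → eval (vA ℓ A x) f = 0 := Iff.rfl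

theorem reg_eval {A : Finset σ} {x : V} (hx : ∀ i ∈ A, ℓ i x ≠ 0) (v : V)
    (f : MvPolynomial σ K) : Reg fun t : K => eval (vA ℓ A (x + t • v)) f := by
  induction f using MvPolynomial.induction_on with
  | C a => simpa using Reg.const a
  | add p q hp hq => simpa only [map_add] using hp.add hq
  | mul_X p i hp =>
    simp only [map_mul, eval_X]
    refine hp.mul ?_
    by_cases hi : i ∈ A
    · simpa [vA, hi] using Reg.inv (hx i hi) (ℓ i v)
    · simpa [vA, hi] using Reg.const (0 : K)

theorem line_zero [Infinite K] {g : K → K} (hg : Reg g) (B : Finset σ) (x v : V)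
    (hB : ∀ i ∈ B, ℓ i x ≠ 0 ∨ ℓ i v ≠ 0)
    (h : ∀ t : K, (∀ i ∈ B, ℓ i (x + t • v) ≠ 0) → g t = 0) : g 0 = 0 := by
  refine hg.zero (S := ⋃ i ∈ B, {t : K | ℓ i (x + t • v) = 0}) ?_ ?_
  · refine Set.Finite.biUnion B.finite_toSet ?_
    intro i hi
    refine Set.Subsingleton.finite ?_
    intro s hs t ht
    simp only [Set.mem_ofPred_eq, map_add, map_smul, smul_eq_mul] at hs ht
    have hv : ℓ i v ≠ 0 := by
      intro hv
      rcases hB i hi with h | h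
      · rw [hv] at hs; apply h; simpa using hs
      · exact h hv
    refine mul_right_cancel₀ hv ?_
    linear_combination hs - ht
  · intro t ht
    refine h t fun i hi h0 => ht ?_
    simp only [Set.mem_iUnion]
    exact ⟨i, hi, h0⟩

/-- Set the `n`-th variable to zero. -/
def kill (n : σ) : MvPolynomial σ K →ₐ[K] MvPolynomial σ K :=
  aeval fun i => if i = n then 0 else X i

theorem eval_kill {n : σ} {A : Finset σ} (hn : n ∉ A) (f : MvPolynomial σ K) (x : V) :
    eval (vA ℓ (insert n A) x) (kill n f) = eval (vA ℓ A x) f := by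
  induction f using MvPolynomial.induction_on with
  | C a => simp [kill]
  | add p q hp hq => simp only [map_add, hp, hq]
  | mul_X p i hp =>
    simp only [map_mul, hp, eval_X]
    congr 1
    unfold kill
    rw [aeval_X]
    by_cases h : i = n
    · subst h; simp [vA, hn]
    · simp [vA, h]

theorem sub_kill (n : σ) (f : MvPolynomial σ K) : ∃ g, f - kill n f = X n * g := by
  induction f using MvPolynomial.induction_on with
  | C a => exact ⟨0, by simp [kill]⟩
  | add p q hp hq =>
    obtain ⟨a, ha⟩ := hp
    obtain ⟨b, hb⟩ := hq
    exact ⟨a + b, by rw [map_add]; linear_combination ha + hb⟩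
  | mul_X p i hp =>
    obtain ⟨a, ha⟩ := hp
    by_cases h : i = n
    · subst h
      refine ⟨p, ?_⟩
      have : kill i (X i : MvPolynomial σ K) = 0 := by simp [kill]
      rw [map_mul, this]; ring
    · refine ⟨a * X i, ?_⟩
      have : kill n (X i : MvPolynomial σ K) = X i := by simp [kill, h]
      rw [map_mul, this]; linear_combination X i * ha

/-- Evaluate a polynomial in the form `ℓ n` with coefficients regular functions. -/
def ev (n : σ) (A : Finset σ) (B : Polynomial (MvPolynomial σ K)) (x : V) : K :=
  B.eval₂ (eval (vA ℓ A x)) (ℓ n x)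

theorem ev_C (n : σ) (A : Finset σ) (f : MvPolynomial σ K) (x : V) :
    ev ℓ n A (Polynomial.C f) x = eval (vA ℓ A x) f := by
  simp [ev]

theorem ev_add (n : σ) (A : Finset σ) (B B' : Polynomial (MvPolynomial σ K)) (x : V) :
    ev ℓ n A (B + B') x = ev ℓ n A B x + ev ℓ n A B' x := by
  simp [ev]

theorem ev_div (n : σ) (A : Finset σ) (B : Polynomial (MvPolynomial σ K)) (x : V) :
    ev ℓ n A B x = eval (vA ℓ A x) (B.coeff 0) + ℓ n x * ev ℓ n A B.divX x := by
  conv_lhs => rw [← Polynomial.divX_mul_X_add B]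
  simp [ev]
  ring

theorem reg_ev {n : σ} {A : Finset σ} {x : V} (hx : ∀ i ∈ A, ℓ i x ≠ 0) (v : V)
    (B : Polynomial (MvPolynomial σ K)) : Reg fun t : K => ev ℓ n A B (x + t • v) := by
  induction B using Polynomial.induction_on' with
  | add p q hp hq => simpa only [ev_add] using hp.add hq
  | monomial k a =>
    simp only [ev, Polynomial.eval₂_monomial]
    refine (reg_eval ℓ hx v a).mul (Reg.pow ?_ k)
    simpa using Reg.aff (ℓ n x) (ℓ n v)

theorem decomp {n : σ} {A : Finset σ} (hn : n ∉ A) (f : MvPolynomial σ K) :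
    ∃ (N : ℕ) (B : Polynomial (MvPolynomial σ K)), B.natDegree ≤ N ∧ ∀ x, ℓ n x ≠ 0 →
      eval (vA ℓ (insert n A) x) f * ℓ n x ^ N = ev ℓ n A B x := by
  let φ : MvPolynomial σ K →ₐ[K] Polynomial (MvPolynomial σ K) :=
    aeval fun i => if i = n then Polynomial.X else Polynomial.C (X i)
  refine ⟨(φ f).natDegree, (φ f).reflect (φ f).natDegree, ?_, ?_⟩
  · simpa using Polynomial.natDegree_reflect_le (N := (φ f).natDegree) (p := φ f)
  · intro x hx
    have h1 : eval (vA ℓ (insert n A) x) f = (φ f).eval₂ (eval (vA ℓ A x)) (ℓ n x)⁻¹ := by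
      induction f using MvPolynomial.induction_on with
      | C a => simp [φ]
      | add p q hp hq => simp only [map_add, hp, hq, Polynomial.eval₂_add]
      | mul_X p i hp =>
        simp only [map_mul, Polynomial.eval₂_mul, hp, eval_X]
        congr 1
        simp only [φ, aeval_X]
        by_cases h : i = n
        · subst h; simp [vA]
        · simp [vA, h]
    let _ : Invertible (ℓ n x)⁻¹ := invertibleOfNonzero (inv_ne_zero hx)
    rw [h1, ← Polynomial.eval₂_reflect_mul_pow (eval (vA ℓ A x)) ((ℓ n x)⁻¹) _ (φ f) le_rfl]
    simp only [invOf_eq_inv, inv_inv, ev]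
    rw [mul_assoc, ← mul_pow, inv_mul_cancel₀ hx, one_pow, mul_one]

variable [Infinite K]

/-- Density: an open condition on the line does not change vanishing. -/
theorem dens {n : σ} {A : Finset σ} {W : Submodule K V} {v : V} (hv : v ∈ W) (hnv : ℓ n v ≠ 0)
    {f : MvPolynomial σ K}
    (h : ∀ x ∈ W, (∀ i ∈ insert n A, ℓ i x ≠ 0) → eval (vA ℓ A x) f = 0) : f ∈ Iv ℓ A W := by
  intro x hx hxA
  have := line_zero ℓ (reg_eval ℓ hxA v f) (insert n A) x v ?_ ?_
  · simpa using this
  · intro i hi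
    rcases Finset.mem_insert.1 hi with rfl | hi
    exacts [Or.inr hnv, Or.inl (hxA i hi)]
  · intro t ht
    exact h _ (add_mem hx (W.smul_mem t hv)) ht

/-- Specialization to the hyperplane. -/
theorem spec {n : σ} {A : Finset σ} {W : Submodule K V} {v : V} (hv : v ∈ W) (hnv : ℓ n v ≠ 0)
    {g : MvPolynomial σ K} {N : ℕ} {B : Polynomial (MvPolynomial σ K)}
    (h : ∀ x ∈ W, (∀ i ∈ insert n A, ℓ i x ≠ 0) →
      eval (vA ℓ A x) g * ℓ n x ^ (N + 1) = ev ℓ n A B x) :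
    B.coeff 0 ∈ Iv ℓ A (W ⊓ LinearMap.ker (ℓ n)) := by
  rintro x ⟨hx, hxn⟩ hxA
  have hl : Reg fun t : K => ℓ n (x + t • v) := by simpa using Reg.aff (ℓ n x) (ℓ n v)
  have := line_zero ℓ (((reg_eval ℓ hxA v g).mul (hl.pow (N + 1))).add
    ((Reg.const (-1)).mul (reg_ev ℓ (n := n) hxA v B))) (insert n A) x v ?_ ?_
  · simp only [zero_smul, add_zero, LinearMap.mem_ker.1 hxn] at this
    rw [ev_div, LinearMap.mem_ker.1 hxn] at this
    simpa using this
  · intro i hi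
    rcases Finset.mem_insert.1 hi with rfl | hi
    exacts [Or.inr hnv, Or.inl (hxA i hi)]
  · intro t ht
    have := h _ (add_mem hx (W.smul_mem t hv)) ht
    simp only [this]
    ring

/-- Combinations of linear forms vanishing on `W`. -/
def TT (A : Finset σ) (W : Submodule K V) : Submodule K (V → K) :=
  Submodule.span K {F | ∃ lam ∈ W.dualAnnihilator, ∃ g : MvPolynomial σ K,
    F = fun x => lam x * eval (vA ℓ A x) g}

theorem TT.zero {A : Finset σ} {W : Submodule K V} {F : V → K} (hF : F ∈ TT ℓ A W) {x : V}
    (hx : x ∈ W) : F x = 0 := by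
  induction hF using Submodule.span_induction with
  | mem F hF =>
    obtain ⟨lam, hl, g, rfl⟩ := hF
    simp [(Submodule.mem_dualAnnihilator lam).1 hl x hx]
  | zero => rfl
  | add a b _ _ ha hb => simp [ha, hb]
  | smul c a _ ha => simp [ha]

theorem TT.mul {A : Finset σ} {W : Submodule K V} {F : V → K} (hF : F ∈ TT ℓ A W)
    (h : MvPolynomial σ K) : (fun x => F x * eval (vA ℓ A x) h) ∈ TT ℓ A W := by
  induction hF using Submodule.span_induction with
  | mem F hF =>
    obtain ⟨lam, hl, g, rfl⟩ := hF
    exact Submodule.subset_span ⟨lam, hl, g * h, by ext x; simp [mul_assoc]⟩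
  | zero =>
    have : (fun x => (0 : V → K) x * eval (vA ℓ A x) h) = 0 := by ext x; simp
    rw [this]; exact zero_mem _
  | add a b _ _ ha hb => convert add_mem ha hb using 1; ext x; simp [add_mul]
  | smul c a _ ha => convert Submodule.smul_mem _ c ha using 1; ext x; simp [mul_assoc]

theorem TT.le {n : σ} {A : Finset σ} (hn : n ∉ A) (W : Submodule K V) :
    TT ℓ A W ≤ TT ℓ (insert n A) W := by
  refine Submodule.span_le.2 ?_
  rintro _ ⟨lam, hl, g, rfl⟩
  exact Submodule.subset_span ⟨lam, hl, kill n g, by ext x; rw [eval_kill ℓ hn]⟩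

theorem TT.split [FiniteDimensional K V] {n : σ} {A : Finset σ} {W : Submodule K V} {F : V → K}
    (hF : F ∈ TT ℓ A (W ⊓ LinearMap.ker (ℓ n))) :
    ∃ u : MvPolynomial σ K, ∃ F1 ∈ TT ℓ A W, ∀ x, F x = ℓ n x * eval (vA ℓ A x) u + F1 x := by
  induction hF using Submodule.span_induction with
  | mem F hF =>
    obtain ⟨lam, hl, g, rfl⟩ := hF
    have hker : LinearMap.ker (ℓ n) = (K ∙ (ℓ n)).dualCoannihilator := by
      ext x
      simp only [LinearMap.mem_ker, Submodule.mem_dualCoannihilator,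
        Submodule.mem_span_singleton]
      constructor
      · rintro h _ ⟨c, rfl⟩
        simp [h]
      · intro h
        exact h _ ⟨1, one_smul _ _⟩
    have hl' : lam ∈ W.dualAnnihilator ⊔ K ∙ (ℓ n) := by
      rw [hker] at hl
      rw [Subspace.dualAnnihilator_inf_eq, Subspace.dualCoannihilator_dualAnnihilator_eq] at hl
      exact hl
    obtain ⟨m, hm, y, hy, rfl⟩ := Submodule.mem_sup.1 hl'
    obtain ⟨c, rfl⟩ := Submodule.mem_span_singleton.1 hy
    refine ⟨C c * g, _, Submodule.subset_span ⟨m, hm, g, rfl⟩, fun x => ?_⟩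
    simp
    ring
  | zero => exact ⟨0, 0, zero_mem _, by simp⟩
  | add a b _ _ ha hb =>
    obtain ⟨u, F, hF, h⟩ := ha
    obtain ⟨u', F', hF', h'⟩ := hb
    exact ⟨u + u', F + F', add_mem hF hF', fun x => by simp [h, h']; ring⟩
  | smul c a _ ha =>
    obtain ⟨u, F, hF, h⟩ := ha
    exact ⟨C c * u, c • F, Submodule.smul_mem _ c hF, fun x => by simp [h]; ring⟩

theorem dvd_aux [FiniteDimensional K V] (A : Finset σ) : ∀ (W : Submodule K V),
    ∀ f ∈ Iv ℓ A W, ∃ F ∈ TT ℓ A W, ∀ x, (∀ i ∈ A, ℓ i x ≠ 0) → eval (vA ℓ A x) f = F x := by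
  induction A using Finset.induction_on with
  | empty =>
    intro W f hf
    refine ⟨0, zero_mem _, fun x _ => ?_⟩
    have := hf 0 W.zero_mem (by simp)
    have h0 : vA ℓ ∅ x = vA ℓ ∅ 0 := by ext i; simp [vA]
    rw [h0, this]; rfl
  | insert n A hn ih =>
    intro W f hf
    by_cases hW : ∀ v ∈ W, ℓ n v = 0
    · refine ⟨_, Submodule.subset_span ⟨ℓ n, (Submodule.mem_dualAnnihilator _).2 hW,
        X n * f, rfl⟩, fun x hx => ?_⟩
      have hx := hx n (Finset.mem_insert_self _ _)
      simp [vA, hx]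
    push Not at hW
    obtain ⟨v, hv, hnv⟩ := hW
    have key : ∀ (N : ℕ) (B : Polynomial (MvPolynomial σ K)), B.natDegree ≤ N →
        (∀ x ∈ W, (∀ i ∈ insert n A, ℓ i x ≠ 0) → ev ℓ n A B x = 0) →
        ∃ F ∈ TT ℓ (insert n A) W, ∀ x, (∀ i ∈ insert n A, ℓ i x ≠ 0) →
          ev ℓ n A B x = ℓ n x ^ N * F x := by
      intro N
      induction N with
      | zero =>
        intro B hB h
        rw [Polynomial.eq_C_of_natDegree_le_zero hB] at h ⊢
        simp only [ev_C] at h ⊢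
        obtain ⟨F, hF, h1⟩ := ih W _ (dens ℓ hv hnv h)
        exact ⟨F, TT.le ℓ hn W hF, fun x hx => by
          rw [h1 x fun i hi => hx i (Finset.mem_insert_of_mem hi)]; simp⟩
      | succ N ihN =>
        intro B hB h
        have hb := spec ℓ hv hnv (g := 0) (N := N) (B := B) (A := A) fun x hx hx' => by
          rw [h x hx hx']; simp
        obtain ⟨F0, hF0, h0⟩ := ih _ _ hb
        obtain ⟨u, F1, hF1, h1⟩ := TT.split ℓ hF0
        have h2 : ∀ x, (∀ i ∈ insert n A, ℓ i x ≠ 0) →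
            ev ℓ n A B x = F1 x + ℓ n x * ev ℓ n A (B.divX + Polynomial.C u) x := by
          intro x hx
          rw [ev_div, h0 x fun i hi => hx i (Finset.mem_insert_of_mem hi), h1, ev_add, ev_C]
          ring
        have hd : (B.divX + Polynomial.C u).natDegree ≤ N := by
          refine (Polynomial.natDegree_add_le _ _).trans ?_
          rw [Polynomial.natDegree_C, Polynomial.natDegree_divX_eq_natDegree_tsub_one]
          refine max_le ?_ (Nat.zero_le _)
          omega
        have hz : ∀ x ∈ W, (∀ i ∈ insert n A, ℓ i x ≠ 0) →
            ev ℓ n A (B.divX + Polynomial.C u) x = 0 := by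
          intro x hx hx'
          have := h2 x hx'
          rw [h x hx hx', TT.zero ℓ hF1 hx, zero_add] at this
          exact (mul_eq_zero.1 this.symm).resolve_left (hx' n (Finset.mem_insert_self _ _))
        obtain ⟨F', hF', h'⟩ := ihN _ hd hz
        refine ⟨_, add_mem (TT.mul ℓ (TT.le ℓ hn W hF1) (X n ^ (N + 1))) hF', ?_⟩
        intro x hx
        rw [h2 x hx, h' x hx]
        have hx := hx n (Finset.mem_insert_self _ _)
        simp [vA]
        field_simp
        ring
    obtain ⟨N, B, hB, h⟩ := decomp ℓ hn f
    obtain ⟨F, hF, hF'⟩ := key N B hB fun x hx hx' => by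
      rw [← h x (hx' n (Finset.mem_insert_self _ _)), hf x hx hx', zero_mul]
    refine ⟨F, hF, fun x hx => ?_⟩
    have h1 := h x (hx n (Finset.mem_insert_self _ _))
    rw [hF' x hx, mul_comm] at h1
    exact mul_left_cancel₀ (pow_ne_zero _ (hx n (Finset.mem_insert_self _ _))) h1

theorem dvd_ell [FiniteDimensional K V] {n : σ} {A : Finset σ} {W : Submodule K V}
    {f : MvPolynomial σ K} (hf : f ∈ Iv ℓ A (W ⊓ LinearMap.ker (ℓ n))) :
    ∃ u : MvPolynomial σ K, ∀ x ∈ W, (∀ i ∈ A, ℓ i x ≠ 0) →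
      eval (vA ℓ A x) f = ℓ n x * eval (vA ℓ A x) u := by
  obtain ⟨F0, hF0, h0⟩ := dvd_aux ℓ A _ _ hf
  obtain ⟨u, F1, hF1, h1⟩ := TT.split ℓ hF0
  refine ⟨u, fun x hx hx' => ?_⟩
  rw [h0 x hx', h1, TT.zero ℓ hF1 hx, add_zero]

end RecLin

namespace RecLin
open MvPolynomial

section gen
variable {K : Type} [Field K] {σ : Type} [Fintype σ]

theorem reg_eval' {v : K → σ → K} (h : ∀ i, Reg fun t => v t i) (f : MvPolynomial σ K) :
    Reg fun t : K => eval (v t) f := by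
  induction f using MvPolynomial.induction_on with
  | C a => simpa using Reg.const a
  | add p q hp hq => simpa only [map_add] using hp.add hq
  | mul_X p i hp =>
    simp only [map_mul, eval_X]
    exact hp.mul (h i)

theorem eval_hom {q : ℕ} {f : MvPolynomial σ K} (hf : f ∈ homogeneousSubmodule σ K q) (s : K)
    (w : σ → K) : eval (s • w) f = s ^ q * eval w f := by
  rw [eval_eq', eval_eq', Finset.mul_sum]
  refine Finset.sum_congr rfl fun d hd => ?_
  have hdeg : d.degree = q := by
    by_contra hne
    exact (mem_support_iff.1 hd) (IsHomogeneous.coeff_eq_zero hf hne)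
  simp only [Pi.smul_apply, smul_eq_mul, mul_pow, Finset.prod_mul_distrib]
  rw [Finset.prod_pow_eq_pow_sum, ← Finsupp.degree_eq_sum, hdeg]
  ring

theorem hom_zero [Infinite K] {f : MvPolynomial σ K} {w : σ → K}
    (h : ∀ s : K, s ≠ 0 → eval (s • w) f = 0) (q : ℕ) :
    eval w (homogeneousComponent q f) = 0 := by
  by_cases hq : q < f.totalDegree + 1
  swap
  · rw [homogeneousComponent_eq_zero _ _ (by omega), map_zero]
  let P : Polynomial K := ∑ i ∈ Finset.range (f.totalDegree + 1),
    Polynomial.monomial i (eval w (homogeneousComponent i f))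
  have hP : P = 0 := by
    refine Polynomial.eq_zero_of_infinite_isRoot P ((Set.finite_singleton (0 : K)).infinite_compl.mono ?_)
    intro s hs
    have := h s hs
    rw [← sum_homogeneousComponent f, map_sum] at this
    simp only [eval_hom (homogeneousComponent_mem _ _)] at this
    rw [Set.mem_ofPred_eq, Polynomial.IsRoot.def, Polynomial.eval_finsetSum, ← this]
    refine Finset.sum_congr rfl fun i _ => ?_
    rw [Polynomial.eval_monomial, mul_comm]
  have h2 : P.coeff q = eval w (homogeneousComponent q f) := by
    simp only [P, Polynomial.finsetSum_coeff, Polynomial.coeff_monomial]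
    rw [Finset.sum_ite_eq' _ q, if_pos (Finset.mem_range.2 hq)]
  rw [← h2, hP, Polynomial.coeff_zero]

theorem comp_map (φ : MvPolynomial σ K →ₐ[K] MvPolynomial σ K)
    (hφ : ∀ q f, f ∈ homogeneousSubmodule σ K q → φ f ∈ homogeneousSubmodule σ K q)
    (q : ℕ) (f : MvPolynomial σ K) :
    homogeneousComponent q (φ f) = φ (homogeneousComponent q f) := by
  conv_lhs => rw [← sum_homogeneousComponent f, map_sum, map_sum]
  simp only [homogeneousComponent_of_mem (hφ _ _ (homogeneousComponent_mem _ _))]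
  rw [Finset.sum_ite_eq]
  split_ifs with h
  · rfl
  · rw [homogeneousComponent_eq_zero, map_zero]
    simpa using h

theorem aeval_hom (g : σ → MvPolynomial σ K) (hg : ∀ i, g i ∈ homogeneousSubmodule σ K 1)
    (q : ℕ) (f : MvPolynomial σ K) (hf : f ∈ homogeneousSubmodule σ K q) :
    aeval g f ∈ homogeneousSubmodule σ K q := by
  have := IsHomogeneous.aeval hf g hg
  rwa [one_mul] at this

end gen

variable {K : Type} [Field K] {σ : Type} [Fintype σ] [DecidableEq σ]
  {V : Type} [AddCommGroup V] [Module K V] (ℓ : σ → Module.Dual K V)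

theorem kill_hom (n : σ) (q : ℕ) (f : MvPolynomial σ K) (hf : f ∈ homogeneousSubmodule σ K q) :
    kill n f ∈ homogeneousSubmodule σ K q := by
  refine aeval_hom _ (fun i => ?_) q f hf
  split_ifs
  · exact zero_mem _
  · exact isHomogeneous_X _ _

theorem vA_smul (A : Finset σ) (t : K) (x : V) : vA ℓ A (t • x) = t⁻¹ • vA ℓ A x := by
  ext i
  simp only [vA, Pi.smul_apply, map_smul, smul_eq_mul]
  split_ifs <;> simp [mul_comm]

variable [Infinite K]

theorem Hm.Iv (A : Finset σ) (W : Submodule K V) : Hm (Iv ℓ A W) := by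
  intro f hf q x hx hxA
  refine hom_zero (fun s hs => ?_) q
  have := hf (s⁻¹ • x) (W.smul_mem _ hx) fun i hi => by
    simpa using ⟨hs, hxA i hi⟩
  rwa [vA_smul, inv_inv] at this

theorem nz_X {n : σ} {A : Finset σ} (W : Submodule K V) :
    Nz (RecLin.Iv ℓ (insert n A) W) (X n) := by
  intro q g _ h x hx hxA
  have := h x hx hxA
  rw [map_mul, eval_X] at this
  refine (mul_eq_zero.1 this).resolve_left ?_
  simpa [vA] using hxA n (Finset.mem_insert_self _ _)

theorem kill_mem {n : σ} {A : Finset σ} (hn : n ∉ A) {W : Submodule K V} {f : MvPolynomial σ K}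
    (hf : f ∈ Iv ℓ A W) : kill n f ∈ Iv ℓ (insert n A) W := by
  intro x hx hxA
  rw [eval_kill ℓ hn]
  exact hf x hx fun i hi => hxA i (Finset.mem_insert_of_mem hi)

theorem mem_of_kill {n : σ} {I : Ideal (MvPolynomial σ K)} {f : MvPolynomial σ K}
    (hf : kill n f ∈ I ⊔ Ideal.span {X n}) : f ∈ I ⊔ Ideal.span {X n} := by
  obtain ⟨g, hg⟩ := sub_kill n f
  have : f = kill n f + X n * g := by rw [← hg]; ring
  rw [this]
  exact add_mem hf (Ideal.mem_sup_right (Ideal.mul_mem_right _ _ (Ideal.mem_span_singleton_self _)))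

theorem Iv_coloop {n : σ} {A : Finset σ} (hn : n ∉ A) {W : Submodule K V} {u : V} (hu : u ∈ W)
    (huA : ∀ i ∈ A, ℓ i u = 0) (hun : ℓ n u ≠ 0) :
    Iv ℓ (insert n A) W ⊔ Ideal.span {X n} = Iv ℓ A W := by
  apply le_antisymm
  · refine sup_le ?_ ((Ideal.span_singleton_le_iff_mem _).2 ?_)
    · intro f hf x hx hxA
      have hr : Reg fun s : K => eval (Function.update (vA ℓ A x) n s) f := by
        refine reg_eval' (fun i => ?_) f
        by_cases h : i = n
        · subst h; simpa using Reg.aff (0 : K) 1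
        · simpa [h] using Reg.const (vA ℓ A x i)
      have := hr.zero (Set.finite_singleton 0) ?_
      · have h0 : Function.update (vA ℓ A x) n 0 = vA ℓ A x := by simp [vA, hn]
        rwa [h0] at this
      · intro s hs
        have hs : s ≠ 0 := hs
        have h1 := hf (x + ((s⁻¹ - ℓ n x) / ℓ n u) • u) (add_mem hx (W.smul_mem _ hu)) ?_
        · rw [← h1]
          refine congrArg (fun w => eval w f) ?_
          ext i
          by_cases h : i = n
          · subst h
            simp [vA, hun]
          · simp only [Function.update_of_ne h, vA, Finset.mem_insert, h, false_or]
            split_ifs with hi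
            · simp [huA i hi]
            · rfl
        · intro i hi
          rcases Finset.mem_insert.1 hi with rfl | hi
          · simpa [hun] using hs
          · simpa [huA i hi] using hxA i hi
    · intro x _ _
      simp [vA, hn]
  · intro f hf
    exact mem_of_kill (Ideal.mem_sup_left (kill_mem ℓ hn hf))

/-- The graph of multiplication by `ℓ n`. -/
def GG (n : σ) (A : Finset σ) (W : Submodule K V) :
    Submodule (MvPolynomial σ K) (MvPolynomial σ K × MvPolynomial σ K) where
  carrier := {p | p.1 ∈ Iv ℓ A (W ⊓ LinearMap.ker (ℓ n)) ∧
    X n * kill n p.1 - kill n p.2 ∈ Iv ℓ (insert n A) W}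
  zero_mem' := ⟨zero_mem _, by simp⟩
  add_mem' := by
    rintro a b ⟨ha, ha'⟩ ⟨hb, hb'⟩
    refine ⟨add_mem ha hb, ?_⟩
    convert add_mem ha' hb' using 1
    simp only [Prod.fst_add, Prod.snd_add, map_add]
    ring
  smul_mem' := by
    rintro c a ⟨ha, ha'⟩
    refine ⟨Ideal.mul_mem_left _ _ ha, ?_⟩
    convert Ideal.mul_mem_left _ (kill n c) ha' using 1
    simp only [Prod.smul_fst, Prod.smul_snd, smul_eq_mul, map_mul]
    ring

theorem GG_iff {n : σ} {A : Finset σ} (hn : n ∉ A) {W : Submodule K V}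
    {f g : MvPolynomial σ K} : X n * kill n f - kill n g ∈ Iv ℓ (insert n A) W ↔
    ∀ x ∈ W, (∀ i ∈ insert n A, ℓ i x ≠ 0) →
      eval (vA ℓ A x) f = ℓ n x * eval (vA ℓ A x) g := by
  rw [mem_Iv]
  refine forall₃_congr fun x hx hxA => ?_
  have hxn := hxA n (Finset.mem_insert_self _ _)
  rw [map_sub, map_mul, eval_kill ℓ hn, eval_kill ℓ hn, eval_X]
  simp only [vA, Finset.mem_insert, true_or, if_true, sub_eq_zero]
  rw [inv_mul_eq_iff_eq_mul₀ hxn]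

theorem cor_main [FiniteDimensional K V] {n : σ} {A : Finset σ} (hn : n ∉ A) {W : Submodule K V}
    {v : V} (hv : v ∈ W) (hnv : ℓ n v ≠ 0) :
    Cor (Iv ℓ A W) (Iv ℓ A (W ⊓ LinearMap.ker (ℓ n)))
      (Iv ℓ (insert n A) W ⊔ Ideal.span {X n}) (GG ℓ n A W) := by
  constructor
  · exact fun f hf x hx => hf x hx.1
  · exact fun f hf => mem_of_kill (Ideal.mem_sup_left (kill_mem ℓ hn hf))
  · rintro ⟨f, g⟩ ⟨h1, h2⟩
    refine ⟨h1, mem_of_kill (mem_sup_iff.2 ⟨kill n f, ?_⟩)⟩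
    rw [← neg_sub]; exact neg_mem h2
  · intro f hf
    obtain ⟨u, hu⟩ := dvd_ell ℓ hf
    exact ⟨u, hf, (GG_iff ℓ hn).2 fun x hx hxA =>
      hu x hx fun i hi => hxA i (Finset.mem_insert_of_mem hi)⟩
  · intro g hg
    have key : ∀ (N : ℕ) (B : Polynomial (MvPolynomial σ K)), B.natDegree ≤ N →
        (∀ x ∈ W, (∀ i ∈ insert n A, ℓ i x ≠ 0) →
          eval (vA ℓ A x) g * ℓ n x ^ (N + 1) = ev ℓ n A B x) → ∃ f, (f, g) ∈ GG ℓ n A W := by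
      intro N
      induction N with
      | zero =>
        intro B hB h
        refine ⟨B.coeff 0, spec ℓ hv hnv h, (GG_iff ℓ hn).2 fun x hx hxA => ?_⟩
        have := h x hx hxA
        rw [Polynomial.eq_C_of_natDegree_le_zero hB, ev_C] at this
        rw [← this]; ring
      | succ N ihN =>
        intro B hB h
        obtain ⟨u, hu⟩ := dvd_ell ℓ (spec ℓ hv hnv h)
        refine ihN (B.divX + Polynomial.C u) ?_ ?_
        · refine (Polynomial.natDegree_add_le _ _).trans ?_
          rw [Polynomial.natDegree_C, Polynomial.natDegree_divX_eq_natDegree_tsub_one]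
          refine max_le ?_ (Nat.zero_le _)
          omega
        · intro x hx hxA
          have h1 := h x hx hxA
          rw [ev_div, hu x hx fun i hi => hxA i (Finset.mem_insert_of_mem hi)] at h1
          refine mul_left_cancel₀ (hxA n (Finset.mem_insert_self _ _)) ?_
          rw [ev_add, ev_C]
          linear_combination h1
    obtain ⟨h, hh⟩ : ∃ h, kill n g - X n * h ∈ Iv ℓ (insert n A) W := by
      refine mem_sup_iff.1 ?_
      obtain ⟨a, ha⟩ := sub_kill n g
      have : kill n g = g - X n * a := by rw [← ha]; ring
      rw [this]
      exact sub_mem hg (Ideal.mem_sup_right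
        (Ideal.mul_mem_right _ _ (Ideal.mem_span_singleton_self _)))
    obtain ⟨N, B, hB, hNB⟩ := decomp ℓ hn h
    refine key N B hB fun x hx hxA => ?_
    have hxn := hxA n (Finset.mem_insert_self _ _)
    rw [← hNB x hxn]
    have := hh x hx hxA
    rw [map_sub, map_mul, eval_kill ℓ hn, eval_X, sub_eq_zero] at this
    rw [this]
    simp only [vA, Finset.mem_insert, true_or, if_true]
    field_simp
    ring
  · rintro ⟨f, g⟩ ⟨h1, h2⟩
    rw [GG_iff ℓ hn] at h2
    constructor
    · intro hf
      refine dens ℓ hv hnv fun x hx hxA => ?_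
      have := h2 x hx hxA
      rw [hf x hx fun i hi => hxA i (Finset.mem_insert_of_mem hi)] at this
      exact (mul_eq_zero.1 this.symm).resolve_left (hxA n (Finset.mem_insert_self _ _))
    · intro hg
      refine dens ℓ hv hnv fun x hx hxA => ?_
      rw [h2 x hx hxA, hg x hx fun i hi => hxA i (Finset.mem_insert_of_mem hi), mul_zero]
  · rintro ⟨f, g⟩ ⟨h1, h2⟩ q
    refine ⟨Hm.Iv ℓ _ _ _ h1 q, ?_⟩
    have := Hm.Iv ℓ _ _ _ h2 (q + 1)
    rw [map_sub, comp_mul (isHomogeneous_X K n), comp_map _ (kill_hom n),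
      comp_map _ (kill_hom n)] at this
    exact this

end RecLin

namespace RecLin
open MvPolynomial

variable {K : Type} [Field K] {σ : Type} [Fintype σ] [DecidableEq σ]
  {V : Type} [AddCommGroup V] [Module K V] (ℓ : σ → Module.Dual K V)

/-- Shear of the coordinates. -/
def shear (n j : σ) (c : K) : MvPolynomial σ K →ₐ[K] MvPolynomial σ K :=
  aeval fun i => if i = n then X n + C c * X j else X i

theorem shear_comp {n j : σ} (hj : j ≠ n) (c : K) :
    (shear n j c).comp (shear n j (-c)) = AlgHom.id K _ := by
  ext1 i
  by_cases h : i = n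
  · subst h
    simp [shear, hj]
  · simp [shear, h]

/-- Shear as an equivalence. -/
def shearE {n j : σ} (hj : j ≠ n) (c : K) : MvPolynomial σ K ≃ₐ[K] MvPolynomial σ K :=
  AlgEquiv.ofAlgHom (shear n j c) (shear n j (-c)) (shear_comp hj c)
    (by simpa using shear_comp hj (-c))

/-- The dual map on coefficients. -/
def shearM {n j : σ} (hj : j ≠ n) (c : K) : (σ → K) ≃ₗ[K] (σ → K) where
  toFun a := a + Pi.single j (c * a n)
  invFun a := a - Pi.single j (c * a n)
  map_add' a b := by
    simp only [Pi.add_apply, mul_add, Pi.single_add]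
    abel
  map_smul' r a := by
    ext i
    by_cases h : i = j
    · subst h; simp; ring
    · simp [h]
  left_inv a := by
    simp [Pi.single_eq_of_ne hj.symm]
  right_inv a := by
    simp [Pi.single_eq_of_ne hj.symm]

theorem shearE_apply {n j : σ} (hj : j ≠ n) (c : K) (f : MvPolynomial σ K) :
    shearE hj c f = shear n j c f := rfl

theorem shearM_apply {n j : σ} (hj : j ≠ n) (c : K) (a : σ → K) :
    shearM hj c a = a + Pi.single j (c * a n) := rfl

theorem shear_lin {n j : σ} (hj : j ≠ n) (c : K) (a : σ → K) :
    shearE hj c (lin a) = lin (shearM hj c a) := by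
  rw [shearE_apply, shearM_apply]
  unfold lin
  simp only [map_sum, map_mul, Pi.add_apply, map_add, add_mul, Finset.sum_add_distrib]
  have h1 : ∑ i, C ((Pi.single j (c * a n) : σ → K) i) * X i = C (c * a n) * (X j : MvPolynomial σ K) := by
    rw [Finset.sum_eq_single j]
    · simp
    · intro b _ hb; simp [hb]
    · simp
  rw [h1]
  have h2 : ∀ i, shear n j c (C (a i)) * shear n j c (X i) =
      C (a i) * X i + if i = n then C (a n) * (C c * X j) else 0 := by
    intro i
    by_cases h : i = n
    · subst h; simp [shear, mul_add]
    · simp [shear, h]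
  simp only [h2, Finset.sum_add_distrib, Finset.sum_ite_eq', Finset.mem_univ, if_true]
  rw [C_mul]
  ring

theorem PP.parallel [Infinite K] {n j : σ} {A : Finset σ} (hn : n ∉ A) (hjA : j ∈ A) {W : Submodule K V}
    {c : K} (hc : c ≠ 0) (h : ∀ x ∈ W, ℓ j x = c * ℓ n x) {e r : ℕ}
    (hP : PP e r (Iv ℓ A W)) : PP e r (Iv ℓ (insert n A) W) := by
  have hj : j ≠ n := by rintro rfl; exact hn hjA
  have h1 : Iv ℓ (insert n A) W = (Iv ℓ A W).comap (shearE hj c) := by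
    ext f
    rw [Ideal.mem_comap, mem_Iv, mem_Iv]
    have hev : ∀ x ∈ W, eval (vA ℓ A x) (shearE hj c f) = eval (vA ℓ (insert n A) x) f := by
      intro x hx
      rw [shearE_apply]
      induction f using MvPolynomial.induction_on with
      | C a => simp [shear]
      | add p q hp hq => simp only [map_add, hp, hq]
      | mul_X p i hp =>
        simp only [map_mul, hp, eval_X]
        congr 1
        by_cases hi : i = n
        · subst hi
          simp [shear, vA, hn, hjA, h x hx]
          field_simp
        · simp [shear, vA, hi]
    refine forall₂_congr fun x hx => ?_
    rw [hev x hx]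
    refine imp_congr_left ?_
    constructor
    · intro h2 i hi
      exact h2 i (Finset.mem_insert_of_mem hi)
    · intro h2 i hi
      rcases Finset.mem_insert.1 hi with rfl | hi
      · intro h3
        apply h2 j hjA
        rw [h x hx, h3, mul_zero]
      · exact h2 i hi
  rw [h1]
  refine PP.comap (shearE hj c) (shearM hj c) (shear_lin hj c) ?_ hP
  intro q f hf
  refine aeval_hom _ (fun i => ?_) q f hf
  split_ifs
  · exact add_mem (isHomogeneous_X _ _) (isHomogeneous_C_mul_X _ _)
  · exact isHomogeneous_X _ _

/-- Common kernel. -/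
def NN (A : Finset σ) (W : Submodule K V) : Submodule K V where
  carrier := {x | x ∈ W ∧ ∀ i ∈ A, ℓ i x = 0}
  zero_mem' := ⟨zero_mem _, by simp⟩
  add_mem' := by
    rintro a b ⟨h1, h2⟩ ⟨h3, h4⟩
    exact ⟨add_mem h1 h3, fun i hi => by simp [h2 i hi, h4 i hi]⟩
  smul_mem' := by
    rintro c a ⟨h1, h2⟩
    exact ⟨W.smul_mem c h1, fun i hi => by simp [h2 i hi]⟩

theorem mem_NN {A : Finset σ} {W : Submodule K V} {x : V} :
    x ∈ NN ℓ A W ↔ x ∈ W ∧ ∀ i ∈ A, ℓ i x = 0 := Iff.rfl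

theorem fr [FiniteDimensional K V] {W : Submodule K V} {f : Module.Dual K V} {v : V} (hv : v ∈ W)
    (hfv : f v ≠ 0) :
    Module.finrank K ↥(W ⊓ LinearMap.ker f) + 1 = Module.finrank K W := by
  let g := f.domRestrict W
  have h1 := g.finrank_range_add_finrank_ker
  have h2 : LinearMap.range g = ⊤ := by
    refine LinearMap.range_eq_top.2 (LinearMap.surjective fun h => hfv ?_)
    exact LinearMap.congr_fun h ⟨v, hv⟩
  have h3 : Module.finrank K (LinearMap.ker g) = Module.finrank K ↥(W ⊓ LinearMap.ker f) := by
    have : W ⊓ LinearMap.ker f = (LinearMap.ker g).map W.subtype := by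
      ext x
      constructor
      · rintro ⟨hx, hx'⟩
        exact ⟨⟨x, hx⟩, hx', rfl⟩
      · rintro ⟨y, hy, rfl⟩
        exact ⟨y.2, hy⟩
    rw [this]
    exact (LinearEquiv.finrank_eq (Submodule.equivMapOfInjective _ W.injective_subtype _))
  rw [h2, finrank_top, Module.finrank_self, h3] at h1
  omega

variable [Infinite K]

theorem main_pp [FiniteDimensional K V] (A : Finset σ) : ∀ (W : Submodule K V) (e : ℕ),
    (∀ i ∈ A, ∃ v ∈ W, ℓ i v ≠ 0) →
    e + Module.finrank K (NN ℓ A W) = Module.finrank K W → PP e (max e 1) (Iv ℓ A W) := by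
  induction A using Finset.induction_on with
  | empty =>
    intro W e _ he
    have : NN ℓ ∅ W = W := by ext x; simp [mem_NN]
    rw [this] at he
    obtain rfl : e = 0 := by omega
    intro q hq f hf x _ _
    have h0 : vA ℓ ∅ x = (0 : K) • (0 : σ → K) := by ext i; simp [vA]
    rw [h0, eval_hom hf, zero_pow (by simp at hq; omega), zero_mul]
  | insert n A hn ih =>
    intro W e hA he
    obtain ⟨v, hv, hnv⟩ := hA n (Finset.mem_insert_self _ _)
    have hA' : ∀ i ∈ A, ∃ v ∈ W, ℓ i v ≠ 0 := fun i hi => hA i (Finset.mem_insert_of_mem hi)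
    have hX : (X n : MvPolynomial σ K) ∈ homogeneousSubmodule σ K 1 := isHomogeneous_X _ _
    by_cases hco : ∃ u ∈ NN ℓ A W, ℓ n u ≠ 0
    · obtain ⟨u, hu, hun⟩ := hco
      have hN : NN ℓ (insert n A) W = NN ℓ A W ⊓ LinearMap.ker (ℓ n) := by
        ext x
        simp only [mem_NN, Submodule.mem_inf, LinearMap.mem_ker, Finset.forall_mem_insert]
        tauto
      have h1 := fr hu hun
      rw [← hN] at h1
      have h2 : Module.finrank K (NN ℓ A W) ≤ Module.finrank K W :=
        Submodule.finrank_mono fun x hx => hx.1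
      obtain ⟨e', rfl⟩ : ∃ e', e = e' + 1 := ⟨e - 1, by omega⟩
      have h3 := ih W e' hA' (by omega)
      rw [← Iv_coloop ℓ hn hu.1 hu.2 hun] at h3
      have h4 := PP.lift (Hm.Iv ℓ (insert n A) W) hX (nz_X ℓ W) (e := e') (r := e')
        (h3.mono (by omega))
      exact h4.mono (by omega)
    push Not at hco
    have hN : NN ℓ (insert n A) W = NN ℓ A W := by
      ext x
      simp only [mem_NN, Finset.forall_mem_insert]
      constructor
      · tauto
      · intro h
        exact ⟨h.1, hco x h, h.2⟩
    have hN' : NN ℓ (insert n A) W = NN ℓ A (W ⊓ LinearMap.ker (ℓ n)) := by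
      ext x
      simp only [mem_NN, Submodule.mem_inf, LinearMap.mem_ker, Finset.forall_mem_insert]
      tauto
    by_cases hpar : ∃ j ∈ A, ∀ x ∈ W, ℓ n x = 0 → ℓ j x = 0
    · obtain ⟨j, hj, hjx⟩ := hpar
      have h1 : ∀ x ∈ W, ℓ j x = ℓ j v / ℓ n v * ℓ n x := by
        intro x hx
        have := hjx (x - (ℓ n x / ℓ n v) • v) (sub_mem hx (W.smul_mem _ hv)) (by simp [hnv])
        simp only [map_sub, map_smul, smul_eq_mul, sub_eq_zero] at this
        rw [this]; ring
      refine PP.parallel ℓ hn hj ?_ h1 (ih W e hA' (by rw [← hN]; exact he))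
      intro h0
      obtain ⟨w, hw, hw'⟩ := hA' j hj
      apply hw'
      rw [h1 w hw, h0, zero_mul]
    push Not at hpar
    have hfr := fr hv hnv
    have hle : Module.finrank K (NN ℓ A (W ⊓ LinearMap.ker (ℓ n))) ≤
        Module.finrank K ↥(W ⊓ LinearMap.ker (ℓ n)) :=
      Submodule.finrank_mono fun x hx => hx.1
    have hne : Module.finrank K (NN ℓ A (W ⊓ LinearMap.ker (ℓ n))) ≠
        Module.finrank K ↥(W ⊓ LinearMap.ker (ℓ n)) := by
      intro heq
      have h1 : NN ℓ A (W ⊓ LinearMap.ker (ℓ n)) = W ⊓ LinearMap.ker (ℓ n) :=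
        Submodule.eq_of_le_of_finrank_eq (fun x hx => hx.1) heq
      rcases A.eq_empty_or_nonempty with rfl | ⟨j, hj⟩
      · exact hnv (hco v ⟨hv, by simp⟩)
      · obtain ⟨x, hx, hx1, hx2⟩ := hpar j hj
        have : x ∈ NN ℓ A (W ⊓ LinearMap.ker (ℓ n)) := by
          rw [h1]; exact ⟨hx, hx1⟩
        exact hx2 (this.2 j hj)
    obtain ⟨r, rfl⟩ : ∃ r, e = r + 2 := ⟨e - 2, by rw [hN'] at he; omega⟩
    have hI := ih W (r + 2) hA' (by rw [← hN]; exact he)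
    have hJ := ih (W ⊓ LinearMap.ker (ℓ n)) (r + 1) (fun j hj => by
      obtain ⟨x, hx, hx1, hx2⟩ := hpar j hj
      exact ⟨x, ⟨hx, hx1⟩, hx2⟩) (by rw [← hN']; omega)
    have h5 := (cor_main ℓ hn hv hnv).pp (Hm.Iv ℓ _ _) (Hm.Iv ℓ _ _)
      ((Hm.Iv ℓ _ _).sup_span hX) (e := r + 1) (r := r + 1) (hI.mono (by omega))
      (hJ.mono (by omega))
    exact (PP.lift (Hm.Iv ℓ _ _) hX (nz_X ℓ W) h5).mono (by omega)

end RecLin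

namespace RecLin
open MvPolynomial


section descent
variable {K : Type} [Field K] {Kb : Type} [Field Kb] [Algebra K Kb] {σ : Type} [Fintype σ]

theorem mem_of_map {I : Ideal (MvPolynomial σ K)} {f : MvPolynomial σ K}
    (h : MvPolynomial.map (algebraMap K Kb) f ∈
      Ideal.map (MvPolynomial.map (algebraMap K Kb)) I) : f ∈ I := by
  let _inst : Algebra (MvPolynomial σ K) (MvPolynomial σ Kb) := algebraMvPolynomial
  have hff : Module.FaithfullyFlat (MvPolynomial σ K) (MvPolynomial σ Kb) := by
    have := Algebra.IsPushout.equiv K (MvPolynomial σ K) Kb (MvPolynomial σ Kb)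
    exact Module.FaithfullyFlat.of_linearEquiv _ _ this.toLinearEquiv.symm
  have h1 := Ideal.comap_map_eq_self_of_faithfullyFlat (B := MvPolynomial σ Kb) I
  rw [← h1]
  exact h

theorem comp_map_alg (q : ℕ) (f : MvPolynomial σ K) :
    homogeneousComponent q (MvPolynomial.map (algebraMap K Kb) f) =
      MvPolynomial.map (algebraMap K Kb) (homogeneousComponent q f) := by
  ext m
  rw [coeff_homogeneousComponent, coeff_map, coeff_map, coeff_homogeneousComponent]
  split_ifs <;> simp

theorem hm_map {I : Ideal (MvPolynomial σ K)} (hI : Hm I) :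
    Hm (Ideal.map (MvPolynomial.map (algebraMap K Kb)) I) := by
  intro f hf
  rw [Ideal.map] at hf
  induction hf using Submodule.span_induction with
  | mem x hx =>
    obtain ⟨a, ha, rfl⟩ := hx
    intro q
    rw [comp_map_alg]
    exact Ideal.mem_map_of_mem _ (hI a ha q)
  | zero => intro q; rw [map_zero]; exact zero_mem _
  | add x y _ _ hx hy => intro q; rw [map_add]; exact add_mem (hx q) (hy q)
  | smul c x _ hx =>
    intro q
    rw [smul_eq_mul, mul_comm]
    rw [← sum_homogeneousComponent x, Finset.sum_mul, map_sum]
    refine sum_mem fun i _ => ?_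
    rcases lt_or_ge q i with h | h
    · rw [comp_mul_lt (homogeneousComponent_mem _ _) _ _ h]
      exact zero_mem _
    · obtain ⟨j, rfl⟩ := Nat.exists_eq_add_of_le' h
      rw [comp_mul (homogeneousComponent_mem _ _)]
      exact Ideal.mul_mem_right _ _ (hx i)

theorem pow_mem_of_finite {J : Ideal (MvPolynomial σ Kb)} (hJ : Hm J)
    (hfin : Module.Finite Kb (MvPolynomial σ Kb ⧸ J)) (i : σ) : ∃ N, (X i : MvPolynomial σ Kb) ^ N ∈ J := by
  obtain ⟨p, hp, hp0⟩ := Algebra.IsIntegral.isIntegral (R := Kb) (Ideal.Quotient.mk J (X i))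
  refine ⟨p.natDegree, ?_⟩
  have h1 : Polynomial.aeval (X i : MvPolynomial σ Kb) p ∈ J := by
    rw [← Ideal.Quotient.eq_zero_iff_mem, ← hp0]
    rw [← Polynomial.aeval_def]
    exact (Polynomial.aeval_algHom_apply (Ideal.Quotient.mkₐ Kb J) (X i) p).symm
  have h2 := hJ _ h1 p.natDegree
  rw [Polynomial.aeval_eq_sum_range, map_sum] at h2
  have h3 : ∀ j, homogeneousComponent p.natDegree (p.coeff j • (X i : MvPolynomial σ Kb) ^ j) =
      if p.natDegree = j then p.coeff j • (X i : MvPolynomial σ Kb) ^ j else 0 := by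
    intro j
    refine homogeneousComponent_of_mem ?_
    exact Submodule.smul_mem _ _ (isHomogeneous_X_pow i j)
  simp only [h3] at h2
  rw [Finset.sum_ite_eq, if_pos (by simp), hp.coeff_natDegree, one_smul] at h2
  exact h2

theorem Ev_of_pow {I : Ideal (MvPolynomial σ K)}
    (h : ∀ i, ∃ N, (X i : MvPolynomial σ K) ^ N ∈ I) : Ev I := by
  have hX : Ideal.span (Set.range (X : σ → MvPolynomial σ K)) ≤ Ideal.radical I := by
    rw [Ideal.span_le]
    rintro _ ⟨i, rfl⟩
    exact h i
  obtain ⟨N, hN⟩ := Ideal.exists_pow_le_of_le_radical_of_fg hX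
    (Submodule.fg_span (Set.finite_range _))
  refine ⟨N, fun q hq f hf => hN (Ideal.pow_le_pow_right hq ?_)⟩
  rw [Ideal.mem_span_pow_iff_exists_isHomogeneous]
  exact ⟨MvPolynomial.map C f, IsHomogeneous.map hf _, by rw [MvPolynomial.eval_map, eval₂_eta]⟩

theorem Ev_of_dim {I : Ideal (MvPolynomial σ K)} (hI : Hm I)
    (hdim : ringKrullDim (MvPolynomial σ Kb ⧸
      Ideal.map (MvPolynomial.map (algebraMap K Kb)) I) = 0) : Ev I := by
  have hfin : Module.Finite Kb (MvPolynomial σ Kb ⧸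
      Ideal.map (MvPolynomial.map (algebraMap K Kb)) I) := by
    rw [Module.finite_iff_krullDimLE_zero, Ring.krullDimLE_iff, hdim]
    simp
  refine Ev_of_pow fun i => ?_
  obtain ⟨N, hN⟩ := pow_mem_of_finite (hm_map hI) hfin i
  refine ⟨N, mem_of_map (Kb := Kb) ?_⟩
  rwa [map_pow, map_X]

theorem ne_top_of_dim {I : Ideal (MvPolynomial σ K)}
    (hdim : ringKrullDim (MvPolynomial σ Kb ⧸
      Ideal.map (MvPolynomial.map (algebraMap K Kb)) I) = 0) : I ≠ ⊤ := by
  rintro rfl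
  rw [Ideal.map_top] at hdim
  have : Subsingleton (MvPolynomial σ Kb ⧸ (⊤ : Ideal (MvPolynomial σ Kb))) :=
    Ideal.Quotient.subsingleton_iff.2 rfl
  rw [ringKrullDim_eq_bot_of_subsingleton] at hdim
  simp at hdim

end descent

section forms
variable {K : Type} [Field K] {d : ℕ} {σ : Type} [Fintype σ] [DecidableEq σ]

/-- The linear form encoded by a column of `L`. -/
def lf (L : Matrix (Fin (d+1)) σ K) (i : σ) : Module.Dual K (Fin (d+1) → K) :=
  ∑ j, L j i • LinearMap.proj j

theorem lf_apply (L : Matrix (Fin (d+1)) σ K) (i : σ) (x : Fin (d+1) → K) :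
    lf L i x = ∑ j, x j * L j i := by
  simp [lf, LinearMap.sum_apply, mul_comm]

theorem ell_eq (L : Matrix (Fin (d+1)) σ K) (i : σ) (x : Fin d → K) :
    ell K L x i = lf L i (Fin.cons 1 x) := by
  rw [lf_apply, Fin.sum_univ_succ]
  simp [ell]

/-- The forms together with the zeroth coordinate. -/
def lf' (L : Matrix (Fin (d+1)) σ K) : Option σ → Module.Dual K (Fin (d+1) → K)
  | none => LinearMap.proj 0
  | some i => lf L i

variable [Infinite K]

theorem vanishing_eq (L : Matrix (Fin (d+1)) σ K) :
    vanishingIdeal K (coneImageK K L) = Iv (lf L) Finset.univ ⊤ := by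
  apply le_antisymm
  · intro f hf x _ hx
    have h1 := reg_eval (lf L) (A := Finset.univ) (x := x) hx (Pi.single 0 1) f
    have h2 := line_zero (lf' L) h1 Finset.univ x (Pi.single 0 1) ?_ ?_
    · simpa using h2
    · rintro (_ | i) _
      · right; simp [lf']
      · left; exact hx i (Finset.mem_univ _)
    · intro t ht
      set y : Fin (d+1) → K := x + t • Pi.single 0 1 with hy
      have hy0 : y 0 ≠ 0 := ht none (Finset.mem_univ _)
      have hyi : ∀ i, lf L i y ≠ 0 := fun i => ht (some i) (Finset.mem_univ _)
      have hc : (Fin.cons 1 (fun j => (y 0)⁻¹ * y (Fin.succ j)) : Fin (d+1) → K) = (y 0)⁻¹ • y := by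
        ext j
        refine Fin.cases ?_ (fun j => ?_) j
        · simp [hy0]
        · simp
      have he : ∀ i, ell K L (fun j => (y 0)⁻¹ * y (Fin.succ j)) i = (y 0)⁻¹ * lf L i y := by
        intro i
        rw [ell_eq, hc, map_smul, smul_eq_mul]
      refine hf _ ⟨(y 0)⁻¹, fun j => (y 0)⁻¹ * y (Fin.succ j), ?_, ?_⟩
      · intro i
        rw [he]
        exact mul_ne_zero (inv_ne_zero hy0) (hyi i)
      · ext i
        rw [he]
        simp only [vA, Finset.mem_univ, if_true]
        have := hyi i
        field_simp
  · intro f hf v hv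
    obtain ⟨c, x, hx, rfl⟩ := hv
    have hxc : ∀ i ∈ (Finset.univ : Finset σ), lf L i (Fin.cons 1 x) ≠ 0 := fun i _ => by
      rw [← ell_eq]; exact hx i
    have hw : (fun i => c / ell K L x i) = c • vA (lf L) Finset.univ (Fin.cons 1 x) := by
      ext i
      simp [vA, ell_eq, div_eq_mul_inv]
    rw [hw, ← sum_homogeneousComponent f, map_sum]
    refine Finset.sum_eq_zero fun q _ => ?_
    rw [eval_hom (homogeneousComponent_mem _ _), (Hm.Iv (lf L) Finset.univ ⊤) f hf q _ trivial hxc,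
      mul_zero]

theorem pp_main (L : Matrix (Fin (d+1)) σ K) (hrank : L.rank = d + 1)
    (hne : vanishingIdeal K (coneImageK K L) ≠ ⊤) :
    PP (d + 1) (d + 1) (vanishingIdeal K (coneImageK K L)) := by
  rw [vanishing_eq] at hne ⊢
  have hli : LinearIndependent K L.row := by
    rw [linearIndependent_iff_card_eq_finrank_span, Set.finrank, ← Matrix.rank_eq_finrank_span_row,
      hrank, Fintype.card_fin]
  have hinj := Matrix.vecMul_injective_iff.2 hli
  have hN : NN (lf L) Finset.univ ⊤ = ⊥ := by
    rw [eq_bot_iff]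
    intro x hx
    rw [mem_NN] at hx
    have : Matrix.vecMul x L = Matrix.vecMul 0 L := by
      ext i
      rw [Matrix.zero_vecMul]
      have := hx.2 i (Finset.mem_univ _)
      rw [lf_apply] at this
      simpa [Matrix.vecMul, dotProduct] using this
    exact hinj this
  have := main_pp (lf L) Finset.univ ⊤ (d + 1) ?_ ?_
  · rwa [max_eq_left (by omega)] at this
  · intro i hi
    by_contra! hcon
    apply hne
    rw [eq_top_iff]
    intro f _ x hx hxA
    exact absurd (hcon x hx) (hxA i hi)
  · rw [hN]
    simp

end forms

theorem concl {K : Type} [Field K] {σ : Type} [Fintype σ] [DecidableEq σ]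
    {I : Ideal (MvPolynomial σ K)} {r : ℕ}
    (h : ∀ q, r ≤ q → ∀ f ∈ homogeneousSubmodule σ K q, f ∈ I) :
    HReg K I ≤ r ∧ ∀ q, r ≤ q → hilb K I q = 0 := by
  have h2 : ∀ q, r ≤ q → hilb K I q = 0 := by
    intro q hq
    have : (homogeneousSubmodule σ K q).map (Ideal.Quotient.mkₐ K I).toLinearMap = ⊥ := by
      rw [eq_bot_iff]
      rintro _ ⟨f, hf, rfl⟩
      exact Ideal.Quotient.eq_zero_iff_mem.2 (h q hq f hf)
    rw [hilb, this, finrank_bot]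
  refine ⟨?_, h2⟩
  have hmem : (r : ℤ) ∈ {i : ℤ | ∃ P : Polynomial ℚ, ∀ q : ℤ, i ≤ q →
      Polynomial.eval (q : ℚ) P = HFZ K I q} := by
    refine ⟨0, fun q hq => ?_⟩
    rw [HFZ, if_pos (by omega), h2 _ (by omega)]
    simp
  unfold HReg
  by_cases hb : BddBelow {i : ℤ | ∃ P : Polynomial ℚ, ∀ q : ℤ, i ≤ q →
      Polynomial.eval (q : ℚ) P = HFZ K I q}
  · exact csInf_le hb hmem
  · rw [Int.csInf_of_not_bddBelow hb]
    omega

theorem final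
    {d : ℕ} {σ : Type} [Fintype σ] [DecidableEq σ] (K : Type) [Field K] [Infinite K]
    (L : Matrix (Fin (d+1)) σ K) (hrank : L.rank = d + 1)
    (ls : Fin d → MvPolynomial σ K)
    (hhom : ∀ j, ls j ∈ MvPolynomial.homogeneousSubmodule σ K 1)
    (hdim1 : ringKrullDim (MvPolynomial σ (AlgebraicClosure K) ⧸
        Ideal.map (MvPolynomial.map (algebraMap K (AlgebraicClosure K)))
          (vanishingIdeal K (coneImageK K L) ⊔ Ideal.span (Set.range ls))) = 1)
    (k : ℕ) (h : MvPolynomial σ K)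
    (hh : h ∈ MvPolynomial.homogeneousSubmodule σ K k)
    (hdim0 : ringKrullDim (MvPolynomial σ (AlgebraicClosure K) ⧸
        Ideal.map (MvPolynomial.map (algebraMap K (AlgebraicClosure K)))
          (vanishingIdeal K (coneImageK K L) ⊔ Ideal.span (Set.range ls) ⊔
            Ideal.span {h})) = 0) :
    ∀ q, d + k ≤ q → ∀ f ∈ homogeneousSubmodule σ K q,
      f ∈ vanishingIdeal K (coneImageK K L) ⊔ Ideal.span (Set.range ls) ⊔ Ideal.span {h} := by
  have hne := ne_top_of_dim hdim0
  have hPP := pp_main L hrank fun ht => hne (by rw [ht, top_sup_eq, top_sup_eq])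
  have hHm : Hm (vanishingIdeal K (coneImageK K L)) := by
    rw [vanishing_eq]; exact Hm.Iv _ _ _
  have hrange : Set.range ls = {g | g ∈ List.ofFn ls} := by
    ext g; simp [List.mem_ofFn']
  rcases k with _ | k
  · exfalso
    have hC : h = C (coeff 0 h) := by
      rw [← totalDegree_eq_zero_iff_eq_C]
      exact Nat.le_zero.1 (IsHomogeneous.totalDegree_le hh)
    by_cases hc : coeff 0 h = 0
    · rw [hc, C_0] at hC
      rw [hC, Ideal.span_singleton_zero, sup_bot_eq, hdim1] at hdim0
      exact one_ne_zero hdim0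
    · apply hne
      rw [Ideal.eq_top_iff_one]
      have : (1 : MvPolynomial σ K) = C (coeff 0 h)⁻¹ * h := by
        rw [hC, coeff_C, if_pos rfl, ← C_mul, inv_mul_cancel₀ hc, C_1]
      rw [this]
      exact Ideal.mul_mem_left _ _ (Ideal.mem_sup_right (Ideal.mem_span_singleton_self _))
  · have hls : ∀ g ∈ List.ofFn ls, g ∈ homogeneousSubmodule σ K 1 := by
      intro g hg
      obtain ⟨j, rfl⟩ := (List.mem_ofFn' _ _).1 hg
      exact hhom j
    have hHm1 : Hm (vanishingIdeal K (coneImageK K L) ⊔ Ideal.span (Set.range ls) ⊔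
        Ideal.span {h}) := by
      rw [hrange]
      exact (hm_sup_list hHm (List.ofFn ls) fun g hg => ⟨0, hls g hg⟩).sup_span hh
    have hev := Ev_of_dim hHm1 hdim0
    rw [hrange] at hev ⊢
    exact PP.vanish hHm (r := d) hh (List.ofFn ls) hls (by rwa [List.length_ofFn]) hev

end RecLin

/-- Theorem 6.2(ii).  With `𝕃` as before and `h ∈ K[ℛ_L]` homogeneous of
degree `k` such that `K̄[ℛ_L]/(I(𝕃) + ⟨h⟩)` has Krull dimension `0`, we have
`HReg(K[ℛ_L]/(I(𝕃)+⟨h⟩)) ≤ d + k` and the Hilbert function vanishes in all degrees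
`q ≥ d + k`. -/
theorem hilbert_function_of_zero_dimensional_section
    {d n : ℕ} (K : Type) [Field K] [CharZero K]
    (L : Matrix (Fin (d+1)) (Fin (n+1)) K) (hrank : L.rank = d + 1)
    (lin : Fin d → MvPolynomial (Fin (n+1)) K)
    (hhom : ∀ j, lin j ∈ MvPolynomial.homogeneousSubmodule (Fin (n+1)) K 1)
    (hindep : LinearIndependent K lin)
    (hdim1 : ringKrullDim (MvPolynomial (Fin (n+1)) (AlgebraicClosure K) ⧸
        Ideal.map (MvPolynomial.map (algebraMap K (AlgebraicClosure K)))
          (vanishingIdeal K (coneImageK K L) ⊔ Ideal.span (Set.range lin))) = 1)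
    (k : ℕ) (h : MvPolynomial (Fin (n+1)) K)
    (hh : h ∈ MvPolynomial.homogeneousSubmodule (Fin (n+1)) K k)
    (hdim0 : ringKrullDim (MvPolynomial (Fin (n+1)) (AlgebraicClosure K) ⧸
        Ideal.map (MvPolynomial.map (algebraMap K (AlgebraicClosure K)))
          (vanishingIdeal K (coneImageK K L) ⊔ Ideal.span (Set.range lin) ⊔
            Ideal.span {h})) = 0) :
    HReg K (vanishingIdeal K (coneImageK K L) ⊔ Ideal.span (Set.range lin) ⊔
        Ideal.span {h}) ≤ d + k ∧
    ∀ q : ℕ, d + k ≤ q →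
      hilb K (vanishingIdeal K (coneImageK K L) ⊔ Ideal.span (Set.range lin) ⊔
        Ideal.span {h}) q = 0 := by
  have : Infinite K := CharZero.infinite K
  have := RecLin.concl (RecLin.final K L hrank lin hhom hdim1 k h hh hdim0)
  exact_mod_cast this

end ScatteringPaper
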